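/- arXiv:2412.03869 — 3 statements merged into one kernel-verified Lean document; each statement's English description precedes it below -/
import Mathlib

section
/- Every connected finite simple graph of order n with n ≥ 7 and size at most ⌊3n/2⌋ has an independent minimum vertex cut, i.e., a vertex cut S with |S| = κ(G) such that S is an independent set of G. -/
open SimpleGraph

/-- `S` is a vertex cut of `G`: a proper subset of the vertex set whose removal
disconnects the graph. -/
def IsVertexCut {V : Type*} [Fintype V] (G : SimpleGraph V) (S : Finset V) : Prop :=
  (S : Set V) ≠ Set.univ ∧ ¬ (G.induce ((S : Set V)ᶜ)).Connected

/-- The connectivity `κ(G)`: the minimum cardinality of a vertex cut of `G`. -/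
noncomputable def graphConnectivity {V : Type*} [Fintype V] (G : SimpleGraph V) : ℕ :=
  sInf {k | ∃ S : Finset V, IsVertexCut G S ∧ S.card = k}

open Classical in
/-- number of ordered adjacent pairs in `X × Y` -/
noncomputable def ee {V : Type*} (G : SimpleGraph V) (X Y : Finset V) : ℕ :=
  ∑ v ∈ X, ∑ w ∈ Y, if G.Adj v w then 1 else 0

/-- `S` separates `A` from `B` in the subgraph induced on `W`. -/
structure GSep {V : Type*} (G : SimpleGraph V) (W S A B : Finset V) : Prop where
  mem : ∀ v, v ∈ W ↔ v ∈ A ∨ v ∈ B ∨ v ∈ S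
  hAB : ∀ v, v ∈ A → v ∉ B
  hAS : ∀ v, v ∈ A → v ∉ S
  hBS : ∀ v, v ∈ B → v ∉ S
  nA : A.Nonempty
  nB : B.Nonempty
  nadj : ∀ a ∈ A, ∀ b ∈ B, ¬ G.Adj a b

theorem GSep.symm' {V : Type*} {G : SimpleGraph V} {W S A B : Finset V} (h : GSep G W S A B) :
    GSep G W S B A where
  mem v := by rw [h.mem]; tauto
  hAB v h1 h2 := h.hAB v h2 h1
  hAS := h.hBS
  hBS := h.hAS
  nA := h.nB
  nB := h.nA
  nadj a ha b hb hab := h.nadj b hb a ha hab.symm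

/-- Every separation of order at most two is along an edge. -/
def Good {V : Type*} [DecidableEq V] (G : SimpleGraph V) (W : Finset V) : Prop :=
  ∀ S A B, GSep G W S A B → S.card ≤ 2 → ∃ x y, S = {x, y} ∧ G.Adj x y

theorem ee_eq {V : Type*} (G : SimpleGraph V) (X Y : Finset V) [∀ v, DecidablePred (G.Adj v)] :
    ee G X Y = ∑ v ∈ X, (Y.filter (G.Adj v)).card := by
  unfold ee
  refine Finset.sum_congr rfl fun v _ => ?_
  rw [Finset.card_filter]
  refine Finset.sum_congr rfl fun w _ => ?_
  by_cases h : G.Adj v w <;> simp [h]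

theorem ee_union_left {V : Type*} [DecidableEq V] (G : SimpleGraph V) (X X' Y : Finset V)
    (h : Disjoint X X') : ee G (X ∪ X') Y = ee G X Y + ee G X' Y := by
  unfold ee; rw [Finset.sum_union h]

theorem ee_comm {V : Type*} (G : SimpleGraph V) (X Y : Finset V) : ee G X Y = ee G Y X := by
  unfold ee; rw [Finset.sum_comm]
  refine Finset.sum_congr rfl fun a _ => Finset.sum_congr rfl fun b _ => ?_
  rw [G.adj_comm]

theorem ee_union_right {V : Type*} [DecidableEq V] (G : SimpleGraph V) (X Y Y' : Finset V)
    (h : Disjoint Y Y') : ee G X (Y ∪ Y') = ee G X Y + ee G X Y' := by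
  rw [ee_comm, ee_union_left _ _ _ _ h, ee_comm, ee_comm G Y']

theorem sep_good {V : Type*} [DecidableEq V] {G : SimpleGraph V} {W S A B : Finset V}
    (hW : Good G W) (h : GSep G W S A B) (hS : S.card ≤ 2) : Good G (A ∪ S) := by
  obtain ⟨x, y, rfl, hxy⟩ := hW _ _ _ h hS
  have key : ∀ S' A' B', GSep G (A ∪ {x, y}) S' A' B' → S'.card ≤ 2 → x ∉ B' → y ∉ B' →
      ∃ x y, S' = {x, y} ∧ G.Adj x y := by
    intro S' A' B' h' hc hx hy
    have hBA : ∀ v, v ∈ B' → v ∈ A := by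
      intro v hv
      have := (h'.mem v).2 (by tauto)
      simp only [Finset.mem_union, Finset.mem_insert, Finset.mem_singleton] at this
      rcases this with h | rfl | rfl <;> tauto
    have hmem := h.mem
    have hmem' := h'.mem
    simp only [Finset.mem_union, Finset.mem_insert, Finset.mem_singleton] at hmem hmem'
    have e1 := h.hAB
    have e2 := h.hAS
    have e3 := h.hBS
    have e4 := h'.hAB
    have e5 := h'.hAS
    have e6 := h'.hBS
    refine hW S' (A' ∪ B) B' ⟨?_, ?_, ?_, h'.hBS, ?_, h'.nB, ?_⟩ hc
    · intro v; simp only [Finset.mem_union]; rw [hmem]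
      have := hmem' v
      tauto
    · intro v hv hv2
      rcases Finset.mem_union.1 hv with hv | hv
      · exact e4 v hv hv2
      · exact e1 v (hBA v hv2) hv
    · intro v hv hv2
      rcases Finset.mem_union.1 hv with hv | hv
      · exact e5 v hv hv2
      · have h3 := (h'.mem v).2 (by tauto)
        rcases Finset.mem_union.1 h3 with h3 | h3
        · exact e1 v h3 hv
        · exact e3 v hv h3
    · exact h'.nA.mono Finset.subset_union_left
    · intro a ha b hb hab
      rcases Finset.mem_union.1 ha with ha | ha
      · exact h'.nadj a ha b hb hab
      · exact h.nadj b (hBA b hb) a ha hab.symm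
  intro S' A' B' h' hc
  by_cases hx : x ∈ B'
  · by_cases hxA : x ∈ A'
    · exact absurd hx (h'.hAB x hxA)
    · refine key S' B' A' h'.symm' hc hxA fun hy => h'.nadj y hy x hx hxy.symm
  · by_cases hy : y ∈ B'
    · refine key S' B' A' h'.symm' hc (fun hx => h'.nadj x hx y hy hxy) fun hy' => h'.hAB y hy' hy
    · exact key S' A' B' h' hc hx hy

theorem deg_sep {V : Type*} [DecidableEq V] {G : SimpleGraph V} {W N : Finset V} {v : V}
    (hv : v ∈ W) (hN : ∀ w, w ∈ N ↔ w ∈ W ∧ G.Adj v w) (hc : N.card + 1 < W.card) :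
    ∃ A B, GSep G W N A B := by
  have hvN : v ∉ N := by rw [hN]; simp
  refine ⟨{v}, W \ (insert v N), ?_, ?_, ?_, ?_, by simp, ?_, ?_⟩
  · intro w
    simp only [Finset.mem_singleton, Finset.mem_sdiff, Finset.mem_insert]
    have := hN w
    by_cases h : w = v
    · subst h; tauto
    · tauto
  · intro w hw; simp only [Finset.mem_singleton] at hw; subst hw; simp
  · intro w hw; simp only [Finset.mem_singleton] at hw; subst hw; exact hvN
  · intro w hw; simp only [Finset.mem_sdiff, Finset.mem_insert] at hw; tauto
  · rw [← Finset.card_pos]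
    have := Finset.le_card_sdiff (insert v N) W
    rw [Finset.card_insert_of_notMem hvN] at this
    omega
  · intro a ha b hb hab
    simp only [Finset.mem_singleton] at ha; subst ha
    simp only [Finset.mem_sdiff, Finset.mem_insert] at hb
    have := hN b
    tauto

theorem min_deg {V : Type*} [DecidableEq V] {G : SimpleGraph V} {W : Finset V} {k : ℕ}
    (hk : k + 1 ≤ W.card) (h : ∀ S A B, GSep G W S A B → k ≤ S.card) :
    k * W.card ≤ ee G W W := by
  classical
  rw [ee_eq, mul_comm, ← smul_eq_mul]
  apply Finset.card_nsmul_le_sum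
  intro v hv
  by_contra hlt
  push Not at hlt
  obtain ⟨A, B, hs⟩ := deg_sep (G := G) (N := W.filter (G.Adj v)) hv (by simp) (by omega)
  have := h _ _ _ hs
  omega

theorem sep_count {V : Type*} [DecidableEq V] {G : SimpleGraph V} {W S A B : Finset V}
    (h : GSep G W S A B) (hS : S.card = 2) :
    ee G (A ∪ S) (A ∪ S) + ee G (B ∪ S) (B ∪ S) ≤ ee G W W + 2 ∧
      (A ∪ S).card = A.card + 2 ∧ (B ∪ S).card = B.card + 2 ∧
      W.card = A.card + B.card + 2 := by
  have dAB : Disjoint A B := Finset.disjoint_left.2 h.hAB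
  have dAS : Disjoint A S := Finset.disjoint_left.2 h.hAS
  have dBS : Disjoint B S := Finset.disjoint_left.2 h.hBS
  have hW : W = (A ∪ B) ∪ S := by ext v; rw [h.mem]; simp [or_assoc]
  have dABS : Disjoint (A ∪ B) S := by simp [dAS, dBS]
  have hss : ee G S S ≤ 2 := by
    obtain ⟨x, y, hxy, rfl⟩ := Finset.card_eq_two.1 hS
    unfold ee
    rw [Finset.sum_pair hxy, Finset.sum_pair hxy, Finset.sum_pair hxy]
    simp only [SimpleGraph.irrefl, if_false]
    split_ifs <;> simp
  refine ⟨?_, ?_, ?_, ?_⟩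
  · rw [hW]
    simp only [ee_union_left _ _ _ _ dABS, ee_union_right _ _ _ _ dABS,
      ee_union_left _ _ _ _ dAB, ee_union_right _ _ _ _ dAB,
      ee_union_left _ _ _ _ dAS, ee_union_right _ _ _ _ dAS,
      ee_union_left _ _ _ _ dBS, ee_union_right _ _ _ _ dBS]
    omega
  · rw [Finset.card_union_of_disjoint dAS, hS]
  · rw [Finset.card_union_of_disjoint dBS, hS]
  · rw [hW, Finset.card_union_of_disjoint dABS, Finset.card_union_of_disjoint dAB, hS]

theorem good_count {V : Type*} [DecidableEq V] {G : SimpleGraph V} : ∀ (k : ℕ) (W : Finset V),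
    W.card = k → 3 ≤ k → Good G W → 4 * k ≤ ee G W W + 6 ∨ 3 * k ≤ ee G W W := by
  intro k
  induction k using Nat.strong_induction_on with
  | _ k ih =>
  intro W hk h3 hW
  have card2 : ∀ S A B, GSep G W S A B → 2 ≤ S.card := by
    intro S A B h
    by_contra hc
    obtain ⟨x, y, rfl, hxy⟩ := hW S A B h (by omega)
    rw [Finset.card_pair hxy.ne] at hc
    omega
  by_cases hex : ∃ S A B, GSep G W S A B ∧ S.card ≤ 2
  · obtain ⟨S, A, B, h, hc⟩ := hex
    have hc2 : S.card = 2 := le_antisymm hc (card2 _ _ _ h)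
    have g1 := sep_good hW h hc
    have g2 := sep_good hW h.symm' hc
    obtain ⟨e, c1, c2, c3⟩ := sep_count h hc2
    have pA := h.nA.card_pos
    have pB := h.nB.card_pos
    have i1 := ih _ (by omega) _ c1 (by omega) g1
    have i2 := ih _ (by omega) _ c2 (by omega) g2
    omega
  · push Not at hex
    by_cases h4 : k = 3
    · have := min_deg (k := 2) (by omega) card2
      omega
    · have := min_deg (G := G) (W := W) (k := 3) (by omega)
        (fun S A B h => hex S A B h)
      omega

theorem cut_of_sep {V : Type*} [Fintype V] {G : SimpleGraph V} {S A B : Finset V}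
    (h : GSep G Finset.univ S A B) : IsVertexCut G S := by
  obtain ⟨a, ha⟩ := h.nA
  obtain ⟨b, hb⟩ := h.nB
  refine ⟨fun he => h.hAS a ha ?_, fun hc => ?_⟩
  · have : a ∈ (S : Set V) := by rw [he]; trivial
    exact this
  · obtain ⟨p⟩ := hc.preconnected ⟨a, by simpa using h.hAS a ha⟩ ⟨b, by simpa using h.hBS b hb⟩
    have key : ∀ (u v : ((S : Set V)ᶜ : Set V)), (G.induce ((S : Set V)ᶜ)).Walk u v →
        u.1 ∈ A → v.1 ∈ A := by
      intro u v p
      induction p with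
      | nil => exact id
      | @cons u v w huv p ih =>
        intro hu
        apply ih
        have h1 : G.Adj u.1 v.1 := huv
        have h2 := h.nadj u.1 hu v.1
        have h3 : v.1 ∉ S := v.2
        have := (h.mem v.1).1 (Finset.mem_univ _)
        tauto
    exact h.hAB b (key _ _ p ha) hb

theorem sep_of_cut {V : Type*} [Fintype V] {G : SimpleGraph V} {S : Finset V}
    (h : IsVertexCut G S) : ∃ A B, GSep G Finset.univ S A B := by
  classical
  obtain ⟨h1, h2⟩ := h
  have hne : Nonempty ((S : Set V)ᶜ : Set V) := by
    rw [Set.nonempty_coe_sort, Set.nonempty_compl]; exact h1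
  have h3 : ¬ (G.induce ((S : Set V)ᶜ)).Preconnected := fun hp => h2 ⟨hp⟩
  unfold SimpleGraph.Preconnected at h3
  push Not at h3
  obtain ⟨u, v, huv⟩ := h3
  refine ⟨Finset.univ.filter fun w => ∃ hw : w ∉ S, (G.induce ((S : Set V)ᶜ)).Reachable u ⟨w, hw⟩,
    Finset.univ.filter fun w => ∃ hw : w ∉ S, ¬ (G.induce ((S : Set V)ᶜ)).Reachable u ⟨w, hw⟩,
    ?_, ?_, ?_, ?_, ?_, ?_, ?_⟩
  · intro w
    simp only [Finset.mem_univ, Finset.mem_filter, true_and, true_iff]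
    by_cases hw : w ∈ S
    · tauto
    · by_cases hr : (G.induce ((S : Set V)ᶜ)).Reachable u ⟨w, hw⟩
      · exact Or.inl ⟨hw, hr⟩
      · exact Or.inr (Or.inl ⟨hw, hr⟩)
  · intro w
    simp only [Finset.mem_univ, Finset.mem_filter, true_and]
    rintro ⟨hw, hr⟩ ⟨_, hr'⟩
    exact hr' hr
  · intro w
    simp only [Finset.mem_univ, Finset.mem_filter, true_and]
    rintro ⟨hw, hr⟩
    exact hw
  · intro w
    simp only [Finset.mem_univ, Finset.mem_filter, true_and]
    rintro ⟨hw, hr⟩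
    exact hw
  · exact ⟨u.1, by
      simp only [Finset.mem_univ, Finset.mem_filter, true_and]
      exact ⟨u.2, Reachable.refl _⟩⟩
  · exact ⟨v.1, by
      simp only [Finset.mem_univ, Finset.mem_filter, true_and]
      exact ⟨v.2, huv⟩⟩
  · intro a ha b hb hab
    simp only [Finset.mem_univ, Finset.mem_filter, true_and] at ha hb
    obtain ⟨ha, hra⟩ := ha
    obtain ⟨hb, hrb⟩ := hb
    apply hrb
    refine hra.trans (Adj.reachable ?_)
    exact hab

theorem card_eq_conn {V : Type*} [Fintype V] {G : SimpleGraph V} {S : Finset V}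
    (h : IsVertexCut G S) (hm : ∀ T, IsVertexCut G T → S.card ≤ T.card) :
    S.card = graphConnectivity G := by
  unfold graphConnectivity
  apply le_antisymm
  · refine le_csInf ⟨S.card, S, h, rfl⟩ ?_
    rintro k ⟨T, hT, rfl⟩
    exact hm T hT
  · exact Nat.sInf_le ⟨S, h, rfl⟩

/-- closed neighbourhood separation on the whole graph -/
theorem sep_univ {V : Type*} [Fintype V] [DecidableEq V] {G : SimpleGraph V} {A N : Finset V}
    (hA : A.Nonempty) (hd : ∀ v ∈ A, v ∉ N) (hn : ∀ a ∈ A, ∀ b, G.Adj a b → b ∈ A ∨ b ∈ N)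
    (hc : A.card + N.card < Fintype.card V) : ∃ A B, GSep G Finset.univ N A B := by
  refine ⟨A, (A ∪ N)ᶜ, ?_, ?_, hd, ?_, hA, ?_, ?_⟩
  · intro v; simp only [Finset.mem_univ, Finset.mem_compl, Finset.mem_union]; tauto
  · intro v; simp only [Finset.mem_compl, Finset.mem_union]; tauto
  · intro v; simp only [Finset.mem_compl, Finset.mem_union]; tauto
  · rw [← Finset.card_pos, Finset.card_compl]
    have := Finset.card_union_le A N
    omega
  · intro a ha b hb hab
    simp only [Finset.mem_compl, Finset.mem_union] at hb
    exact hb (hn a ha b hab)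

theorem ee_univ {V : Type*} [Fintype V] (G : SimpleGraph V) :
    ee G Finset.univ Finset.univ = 2 * G.edgeSet.ncard := by
  classical
  have h := G.sum_degrees_eq_twice_card_edges
  rw [Set.ncard_eq_toFinset_card', ← SimpleGraph.edgeFinset, ← h]
  unfold ee
  apply Finset.sum_congr rfl
  intro v _
  rw [← Finset.card_filter, ← SimpleGraph.card_neighborFinset_eq_degree]
  congr 1
  ext w; simp

/-- the neighbours of `v` are exactly the distinct vertices `x, y, z` -/
def Nb {V : Type*} (G : SimpleGraph V) (v x y z : V) : Prop :=
  x ≠ y ∧ x ≠ z ∧ y ≠ z ∧ ∀ w, G.Adj v w ↔ w = x ∨ w = y ∨ w = z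

theorem cubic_contra {V : Type*} [Fintype V] {G : SimpleGraph V}
    (h7 : 7 ≤ Fintype.card V)
    (hno : ∀ S A B, GSep G Finset.univ S A B → 3 ≤ S.card)
    (h3 : ∀ v, ∃ x y z, Nb G v x y z)
    (hind : ∀ S A B, GSep G Finset.univ S A B → S.card = 3 → ∃ a ∈ S, ∃ b ∈ S, G.Adj a b) :
    False := by
  classical
  -- third neighbour
  have third : ∀ v x y, G.Adj v x → G.Adj v y → x ≠ y → ∃ z, Nb G v x y z := by
    intro v x y hx hy hxy
    obtain ⟨p, q, r, h1, h2, h3, h⟩ := h3 v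
    have hx' := (h x).1 hx
    have hy' := (h y).1 hy
    unfold Nb
    rcases hx' with rfl | rfl | rfl <;> rcases hy' with rfl | rfl | rfl
    · exact absurd rfl hxy
    · exact ⟨r, by tauto, by tauto, by tauto, fun w => by rw [h]⟩
    · exact ⟨q, by tauto, by tauto, Ne.symm (by tauto), fun w => by rw [h]; tauto⟩
    · exact ⟨r, by tauto, by tauto, by tauto, fun w => by rw [h]; tauto⟩
    · exact absurd rfl hxy
    · exact ⟨p, by tauto, Ne.symm (by tauto), Ne.symm (by tauto), fun w => by rw [h]; tauto⟩
    · exact ⟨q, by tauto, Ne.symm (by tauto), by tauto, fun w => by rw [h]; tauto⟩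
    · exact ⟨p, by tauto, Ne.symm (by tauto), Ne.symm (by tauto), fun w => by rw [h]; tauto⟩
    · exact absurd rfl hxy
  -- every vertex in a triangle
  have tri : ∀ v, ∃ x y, G.Adj v x ∧ G.Adj v y ∧ G.Adj x y := by
    intro v
    obtain ⟨p, q, r, h1, h2, h3, h⟩ := h3 v
    have hc : ({p, q, r} : Finset V).card = 3 := Finset.card_eq_three.2 ⟨p, q, r, h1, h2, h3, rfl⟩
    obtain ⟨A, B, hs⟩ := sep_univ (G := G) (A := {v}) (N := {p, q, r}) (by simp)
      (by
        intro w hw; rw [Finset.mem_singleton] at hw; subst hw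
        have := h w
        simp only [SimpleGraph.irrefl, false_iff] at this
        simpa using this)
      (by
        intro a ha b hab; rw [Finset.mem_singleton] at ha; subst ha
        right; simpa using (h b).1 hab)
      (by rw [hc, Finset.card_singleton]; omega)
    obtain ⟨a, ha, b, hb, hab⟩ := hind _ _ _ hs hc
    refine ⟨a, b, (h a).2 (by simpa using ha), (h b).2 (by simpa using hb), hab⟩
  -- no diamond
  have nodiam : ∀ v a b c d, Nb G v a b c → Nb G a v b d → c ≠ d := by
    rintro v a b c d ⟨h1, h2, h3, h⟩ ⟨k1, k2, k3, k⟩ rfl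
    have va : G.Adj v a := (h a).2 (by simp)
    have vb : G.Adj v b := (h b).2 (by simp)
    have vc : G.Adj v c := (h c).2 (by simp)
    have ab : G.Adj a b := (k b).2 (by simp)
    have ac : G.Adj a c := (k c).2 (by simp)
    have := Finset.card_le_two (a := v) (b := a)
    have := Finset.card_le_two (a := b) (b := c)
    obtain ⟨A, B, hs⟩ := sep_univ (G := G) (A := {v, a}) (N := {b, c}) (by simp)
      (by simp [vb.ne, vc.ne, ab.ne, ac.ne])
      (by
        intro w hw b' hb'
        simp only [Finset.mem_insert, Finset.mem_singleton] at hw ⊢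
        rcases hw with rfl | rfl
        · have := (h b').1 hb'; tauto
        · have := (k b').1 hb'; tauto)
      (by omega)
    have := hno _ _ _ hs
    omega
  -- main configuration
  have main : ∀ v a b v' a' b', Nb G v a b v' → Nb G a v b a' → Nb G b v a b' →
      v' ≠ a' → v' ≠ b' → a' ≠ b' → ¬ G.Adj v' a' := by
    rintro v a b v' a' b' ⟨h1, h2, h3, h⟩ ⟨k1, k2, k3, k⟩ ⟨l1, l2, l3, l⟩ d1 d2 d3 hadj
    have va : G.Adj v a := (h a).2 (by simp)
    have vb : G.Adj v b := (h b).2 (by simp)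
    have vv' : G.Adj v v' := (h v').2 (by simp)
    have ab : G.Adj a b := (k b).2 (by simp)
    have aa' : G.Adj a a' := (k a').2 (by simp)
    obtain ⟨x, m1, m2, m3, m⟩ := third v' v a' vv'.symm hadj k2
    obtain ⟨y, n1, n2, n3, n⟩ := third a' a v' aa'.symm hadj.symm h2
    have v'x : G.Adj v' x := (m x).2 (by simp)
    have nva' : ¬ G.Adj v a' := by
      rw [h]; rintro (e | e | e)
      · exact aa'.ne e.symm
      · exact k3 e.symm
      · exact d1 e.symm
    have nav' : ¬ G.Adj a v' := by
      rw [k]; rintro (e | e | e)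
      · exact vv'.ne e.symm
      · exact h3 e.symm
      · exact d1 e
    have nbv' : ¬ G.Adj b v' := by
      rw [l]; rintro (e | e | e)
      · exact vv'.ne e.symm
      · exact h2 e.symm
      · exact d2 e
    have nvx : ¬ G.Adj v x := by
      rw [h]; rintro (e | e | e)
      · subst e; exact nav' v'x.symm
      · subst e; exact nbv' v'x.symm
      · exact v'x.ne e.symm
    have a'x : G.Adj a' x := by
      obtain ⟨p, q, hp, hq, hpq⟩ := tri v'
      have hpq' := hpq.symm
      rcases (m p).1 hp with rfl | rfl | rfl <;> rcases (m q).1 hq with rfl | rfl | rfl <;>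
        first
          | exact hpq
          | exact hpq'
          | exact absurd hpq (SimpleGraph.irrefl _)
          | exact absurd hpq nva'
          | exact absurd hpq' nva'
          | exact absurd hpq nvx
          | exact absurd hpq' nvx
    have xy : x = y := by
      rcases (n x).1 a'x with e | e | e
      · subst e; exact absurd v'x.symm nav'
      · exact absurd e.symm v'x.ne
      · exact e
    subst xy
    have c4 := Finset.card_le_four (a := v) (b := a) (c := v') (d := a')
    have c2 := Finset.card_le_two (a := b) (b := x)
    obtain ⟨A, B, hs⟩ := sep_univ (G := G) (A := {v, a, v', a'}) (N := {b, x}) (by simp)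
      (by
        intro w hw
        simp only [Finset.mem_insert, Finset.mem_singleton] at hw ⊢
        rcases hw with rfl | rfl | rfl | rfl
        · rintro (e | e)
          · exact vb.ne e
          · exact m2 e
        · rintro (e | e)
          · exact ab.ne e
          · exact n2 e
        · rintro (e | e)
          · exact h3 e.symm
          · exact v'x.ne e
        · rintro (e | e)
          · exact k3 e.symm
          · exact a'x.ne e)
      (by
        intro w hw b' hb'
        simp only [Finset.mem_insert, Finset.mem_singleton] at hw ⊢
        rcases hw with rfl | rfl | rfl | rfl
        · have := (h b').1 hb'; tauto
        · have := (k b').1 hb'; tauto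
        · have := (m b').1 hb'; tauto
        · have := (n b').1 hb'; tauto)
      (by omega)
    have := hno _ _ _ hs
    omega
  have swap : ∀ v x y z, Nb G v x y z → Nb G v y x z := by
    rintro v x y z ⟨h1, h2, h3, h⟩
    exact ⟨h1.symm, h3, h2, fun w => by rw [h]; tauto⟩
  have : Nonempty V := Fintype.card_pos_iff.1 (by omega)
  obtain ⟨v⟩ := this
  obtain ⟨a, b, va, vb, ab⟩ := tri v
  obtain ⟨v', Nv⟩ := third v a b va vb ab.ne
  obtain ⟨a', Na⟩ := third a v b va.symm ab vb.ne
  obtain ⟨b', Nbb⟩ := third b v a vb.symm ab.symm va.ne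
  have d1 := nodiam _ _ _ _ _ Nv Na
  have d2 := nodiam _ _ _ _ _ (swap _ _ _ _ Nv) Nbb
  have d3 := nodiam _ _ _ _ _ (swap _ _ _ _ Na) (swap _ _ _ _ Nbb)
  have t1 := main _ _ _ _ _ _ Nv Na Nbb d1 d2 d3
  have t2 := main _ _ _ _ _ _ (swap _ _ _ _ Nv) Nbb Na d2 d1 d3.symm
  have t3 := main _ _ _ _ _ _ (swap _ _ _ _ Na) (swap _ _ _ _ Nbb) Nv d3 d1.symm d2.symm
  have hc : ({v', a', b'} : Finset V).card = 3 :=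
    Finset.card_eq_three.2 ⟨v', a', b', d1, d2, d3, rfl⟩
  have c3 := Finset.card_le_three (a := v) (b := a) (c := b)
  obtain ⟨h1, h2, h3, h⟩ := Nv
  obtain ⟨k1, k2, k3, k⟩ := Na
  obtain ⟨l1, l2, l3, l⟩ := Nbb
  have vv' : G.Adj v v' := (h v').2 (by simp)
  have aa' : G.Adj a a' := (k a').2 (by simp)
  have bb' : G.Adj b b' := (l b').2 (by simp)
  obtain ⟨A, B, hs⟩ := sep_univ (G := G) (A := {v, a, b}) (N := {v', a', b'}) (by simp)
    (by
      intro w hw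
      simp only [Finset.mem_insert, Finset.mem_singleton] at hw ⊢
      rcases hw with rfl | rfl | rfl
      · rintro (e | e | e)
        · exact vv'.ne e
        · exact k2 e
        · exact l2 e
      · rintro (e | e | e)
        · exact h2 e
        · exact aa'.ne e
        · exact l3 e
      · rintro (e | e | e)
        · exact h3 e
        · exact k3 e
        · exact bb'.ne e)
    (by
      intro w hw u hu
      simp only [Finset.mem_insert, Finset.mem_singleton] at hw ⊢
      rcases hw with rfl | rfl | rfl
      · have := (h u).1 hu; tauto
      · have := (k u).1 hu; tauto
      · have := (l u).1 hu; tauto)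
    (by omega)
  obtain ⟨p, hp, q, hq, hpq⟩ := hind _ _ _ hs hc
  simp only [Finset.mem_insert, Finset.mem_singleton] at hp hq
  have hpq' := hpq.symm
  rcases hp with rfl | rfl | rfl <;> rcases hq with rfl | rfl | rfl <;>
    first
      | exact absurd hpq (SimpleGraph.irrefl _)
      | exact t1 hpq
      | exact t1 hpq'
      | exact t2 hpq
      | exact t2 hpq'
      | exact t3 hpq'
      | exact t3 hpq

/-- Every connected graph of order `n ≥ 7` and size at most `⌊3n/2⌋` has an
independent minimum vertex cut. -/
theorem independent_minimum_vertex_cut_of_size_le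
    {V : Type*} [Fintype V] (G : SimpleGraph V) (n : ℕ)
    (hn : Fintype.card V = n) (h7 : 7 ≤ n)
    (hconn : G.Connected)
    (hsize : G.edgeSet.ncard ≤ 3 * n / 2) :
    ∃ S : Finset V, IsVertexCut G S ∧ S.card = graphConnectivity G ∧
      ∀ a ∈ S, ∀ b ∈ S, ¬ G.Adj a b := by
  classical
  have hee : ee G Finset.univ Finset.univ ≤ 3 * n := by rw [ee_univ]; omega
  have hu : (Finset.univ : Finset V).card = n := by rw [Finset.card_univ, hn]
  by_cases c1 : ∃ S, IsVertexCut G S ∧ S.card ≤ 1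
  · obtain ⟨S₀, hS₀, hc₀⟩ := c1
    obtain ⟨S, hS, hmin⟩ := exists_minimal_of_wellFoundedLT
      (fun k => ∃ S : Finset V, IsVertexCut G S ∧ S.card = k) ⟨_, S₀, hS₀, rfl⟩
    obtain ⟨S, hS, rfl⟩ := hS
    have hm : ∀ T, IsVertexCut G T → S.card ≤ T.card := by
      intro T hT
      by_contra hlt
      exact hlt (hmin ⟨T, hT, rfl⟩ (by omega))
    refine ⟨S, hS, card_eq_conn hS hm, ?_⟩
    intro a ha b hb hab
    exact hab.ne (Finset.card_le_one.1 ((hm _ hS₀).trans hc₀) a ha b hb)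
  push Not at c1
  by_cases c2 : ∃ S, IsVertexCut G S ∧ S.card = 2
  · obtain ⟨S₀, hS₀, hc₀⟩ := c2
    by_contra hcon
    push Not at hcon
    have hgood : Good G Finset.univ := by
      intro S A B hs hc
      have hcut := cut_of_sep hs
      have hcc := c1 S hcut
      obtain ⟨a, ha, b, hb, hab⟩ := hcon S hcut (card_eq_conn hcut fun T hT => by
        have := c1 T hT; omega)
      refine ⟨a, b, (Finset.eq_of_subset_of_card_le ?_ ?_).symm, hab⟩
      · intro w hw
        simp only [Finset.mem_insert, Finset.mem_singleton] at hw
        rcases hw with rfl | rfl <;> assumption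
      · rw [Finset.card_pair hab.ne]; omega
    obtain ⟨A, B, h⟩ := sep_of_cut hS₀
    have g1 := sep_good hgood h hc₀.le
    have g2 := sep_good hgood h.symm' hc₀.le
    obtain ⟨e, k1, k2, k3⟩ := sep_count h hc₀
    have pA := h.nA.card_pos
    have pB := h.nB.card_pos
    have i1 := good_count _ _ k1 (by omega) g1
    have i2 := good_count _ _ k2 (by omega) g2
    omega
  push Not at c2
  have hno : ∀ S, IsVertexCut G S → 3 ≤ S.card := by
    intro S hS
    have := c1 S hS
    have := c2 S hS
    omega
  by_contra hcon
  push Not at hcon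
  refine cubic_contra (G := G) (by omega) (fun S A B h => hno S (cut_of_sep h)) ?_ ?_
  · have hdeg : ∀ v, 3 ≤ (Finset.univ.filter (G.Adj v)).card := by
      intro v
      by_contra hlt
      push Not at hlt
      obtain ⟨A, B, hs⟩ := deg_sep (G := G) (W := Finset.univ)
        (N := Finset.univ.filter (G.Adj v)) (Finset.mem_univ v) (by simp) (by omega)
      have := hno _ (cut_of_sep hs)
      omega
    have hsum : ∑ v : V, 3 = ∑ v : V, (Finset.univ.filter (G.Adj v)).card := by
      apply le_antisymm
      · exact Finset.sum_le_sum fun v _ => hdeg v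
      · rw [ee_eq] at hee
        simp only [Finset.sum_const, hu, smul_eq_mul]
        omega
    have heq := (Finset.sum_eq_sum_iff_of_le fun v _ => hdeg v).1 hsum
    intro v
    obtain ⟨x, y, z, h1, h2, h3, h⟩ := Finset.card_eq_three.1 (heq v (Finset.mem_univ v)).symm
    refine ⟨x, y, z, h1, h2, h3, fun w => ?_⟩
    have : w ∈ Finset.univ.filter (G.Adj v) ↔ w ∈ ({x, y, z} : Finset V) := by rw [h]
    simpa using this
  · intro S A B hs hc
    have hcut := cut_of_sep hs
    exact hcon S hcut (card_eq_conn hcut fun T hT => by have := hno T hT; omega)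
end

section
/- Every connected finite simple graph of order n with n ≥ 7 and size at most 2n has a foresty minimum vertex cut, i.e., a vertex cut S with |S| = κ(G) such that the induced subgraph G[S] is a forest. -/
open SimpleGraph

lemma cut_of {V : Type*} [Fintype V] {G : SimpleGraph V} (A S : Finset V)
    (a : V) (ha : a ∈ A) (haS : a ∉ S) (w : V) (hw : w ∉ A) (hwS : w ∉ S)
    (h : ∀ x ∈ A, ∀ y, G.Adj x y → y ∈ A ∨ y ∈ S) : IsVertexCut G S := by
  refine ⟨fun hS => haS ?_, fun hc => ?_⟩
  · have : a ∈ (S : Set V) := by rw [hS]; trivial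
    simpa using this
  · have key : ∀ (p q : ((S : Set V)ᶜ : Set V)), (G.induce ((S : Set V)ᶜ)).Walk p q →
        (p : V) ∈ A → (q : V) ∈ A := by
      intro p q W
      induction W with
      | nil => exact id
      | @cons u v w' huv _ ih =>
        intro hu
        apply ih
        rcases h _ hu _ huv with h1 | h1
        · exact h1
        · exact absurd h1 (fun hh => v.2 hh)
    obtain ⟨W⟩ := hc.preconnected ⟨a, by simpa using haS⟩ ⟨w, by simpa using hwS⟩
    exact hw (key _ _ W ha)

lemma cut_of_card {V : Type*} [Fintype V] [DecidableEq V] {G : SimpleGraph V} (A S : Finset V)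
    (a : V) (ha : a ∈ A) (haS : a ∉ S) (hcard : A.card + S.card < Fintype.card V)
    (h : ∀ x ∈ A, ∀ y, G.Adj x y → y ∈ A ∨ y ∈ S) : IsVertexCut G S := by
  have : ∃ w, w ∉ A ∪ S := by
    by_contra! hh
    have : A ∪ S = Finset.univ := by ext; simp [hh]
    have h2 := Finset.card_union_le A S
    rw [this, Finset.card_univ] at h2
    omega
  obtain ⟨w, hw⟩ := this
  simp only [Finset.mem_union, not_or] at hw
  exact cut_of A S a ha haS w hw.1 hw.2 h

lemma exists_sides {V : Type*} [Fintype V] [DecidableEq V] {G : SimpleGraph V} (S : Finset V)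
    (h : IsVertexCut G S) : ∃ A B : Finset V, A.Nonempty ∧ B.Nonempty ∧
      (∀ x, x ∈ S ∨ x ∈ A ∨ x ∈ B) ∧ (∀ x ∈ A, x ∉ S ∧ x ∉ B) ∧ (∀ x ∈ B, x ∉ S) ∧
      (∀ x ∈ A, ∀ y ∈ B, ¬ G.Adj x y) := by
  classical
  obtain ⟨h1, h2⟩ := h
  have hne : ∃ p, p ∉ S := by
    by_contra! hh
    exact h1 (by ext; simp [hh])
  obtain ⟨p, hp⟩ := hne
  have h3 : ¬ (G.induce ((S : Set V)ᶜ)).Preconnected := fun hh =>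
    h2 (by
      have : Nonempty ((S : Set V)ᶜ : Set V) := ⟨⟨p, by simpa using hp⟩⟩
      exact ⟨hh⟩)
  unfold SimpleGraph.Preconnected at h3
  push Not at h3
  obtain ⟨u, v, huv⟩ := h3
  let A : Finset V := Finset.univ.filter fun x =>
    ∃ hx : x ∈ ((S : Set V)ᶜ : Set V), (G.induce ((S : Set V)ᶜ)).Reachable u ⟨x, hx⟩
  let B : Finset V := Finset.univ.filter fun x => x ∉ S ∧ x ∉ A
  refine ⟨A, B, ⟨u, ?_⟩, ⟨v, ?_⟩, ?_, ?_, ?_, ?_⟩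
  · simp only [A, Finset.mem_filter, Finset.mem_univ, true_and]
    exact ⟨u.2, SimpleGraph.Reachable.refl _⟩
  · simp only [B, A, Finset.mem_filter, Finset.mem_univ, true_and]
    exact ⟨fun hh => v.2 hh, fun ⟨_, h⟩ => huv h⟩
  · intro x
    simp only [B, Finset.mem_filter, Finset.mem_univ, true_and]
    tauto
  · intro x hx
    refine ⟨?_, ?_⟩
    · simp only [A, Finset.mem_filter, Finset.mem_univ, true_and] at hx
      simpa using hx.1
    · simp only [B, Finset.mem_filter, Finset.mem_univ, true_and]
      tauto
  · intro x hx
    simp only [B, Finset.mem_filter, Finset.mem_univ, true_and] at hx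
    exact hx.1
  · intro x hx y hy hxy
    simp only [B, Finset.mem_filter, Finset.mem_univ, true_and] at hy
    apply hy.2
    simp only [A, Finset.mem_filter, Finset.mem_univ, true_and] at hx ⊢
    obtain ⟨hx1, hx2⟩ := hx
    refine ⟨by simpa using hy.1, hx2.trans (SimpleGraph.Adj.reachable ?_)⟩
    exact hxy

lemma core_of_not_acyclic {V : Type*} [Fintype V] [DecidableEq V] {G : SimpleGraph V}
    (S : Finset V) (h : ¬ (G.induce (S : Set V)).IsAcyclic) :
    ∃ C ⊆ S, C.Nonempty ∧ ∀ x ∈ C, ∃ y ∈ C, ∃ z ∈ C, y ≠ z ∧ G.Adj x y ∧ G.Adj x z := by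
  classical
  unfold SimpleGraph.IsAcyclic at h
  push Not at h
  obtain ⟨v, c, hc⟩ := h
  refine ⟨c.support.toFinset.image (Subtype.val), ?_, ?_, ?_⟩
  · intro x hx
    simp only [Finset.mem_image, List.mem_toFinset] at hx
    obtain ⟨y, _, rfl⟩ := hx
    exact y.2
  · exact ⟨v, Finset.mem_image.2 ⟨v, by simp, rfl⟩⟩
  · intro x hx
    simp only [Finset.mem_image, List.mem_toFinset] at hx
    obtain ⟨x', hx', rfl⟩ := hx
    have h2 := hc.ncard_neighborSet_toSubgraph_eq_two hx'
    obtain ⟨y, z, hyz, he⟩ := Set.ncard_eq_two.1 h2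
    have hy : c.toSubgraph.Adj x' y := by
      have : y ∈ c.toSubgraph.neighborSet x' := by rw [he]; simp
      exact this
    have hz : c.toSubgraph.Adj x' z := by
      have : z ∈ c.toSubgraph.neighborSet x' := by rw [he]; simp
      exact this
    refine ⟨y, ?_, z, ?_, fun hh => hyz (Subtype.ext hh), hy.adj_sub, hz.adj_sub⟩
    · exact Finset.mem_image.2 ⟨y, by simpa using hy.snd_mem, rfl⟩
    · exact Finset.mem_image.2 ⟨z, by simpa using hz.snd_mem, rfl⟩

lemma nbr_three {V : Type*} [Fintype V] [DecidableEq V] {G : SimpleGraph V} [DecidableRel G.Adj]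
    {v x y : V} (hd : G.degree v = 3) (hx : G.Adj v x) (hy : G.Adj v y) (hxy : x ≠ y) :
    ∃ z, z ≠ x ∧ z ≠ y ∧ ∀ u, G.Adj v u ↔ u = x ∨ u = y ∨ u = z := by
  have hc : ((G.neighborFinset v \ {x, y})).card = 1 := by
    rw [Finset.card_sdiff_of_subset, G.card_neighborFinset_eq_degree, hd, Finset.card_pair hxy]
    intro u; simp; rintro (rfl | rfl) <;> assumption
  obtain ⟨z, hz⟩ := Finset.card_eq_one.1 hc
  have h : ∀ u, (G.Adj v u ∧ ¬ (u = x ∨ u = y)) ↔ u = z := by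
    intro u
    have := congrArg (u ∈ ·) hz
    simpa using this
  exact ⟨z, by grind, by grind, by grind⟩

lemma nbr_four {V : Type*} [Fintype V] [DecidableEq V] {G : SimpleGraph V} [DecidableRel G.Adj]
    {v x y z : V} (hd : G.degree v = 4) (hx : G.Adj v x) (hy : G.Adj v y) (hz : G.Adj v z)
    (hxy : x ≠ y) (hxz : x ≠ z) (hyz : y ≠ z) :
    ∃ w, w ≠ x ∧ w ≠ y ∧ w ≠ z ∧ ∀ u, G.Adj v u ↔ u = x ∨ u = y ∨ u = z ∨ u = w := by
  have hc : ((G.neighborFinset v \ {x, y, z})).card = 1 := by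
    rw [Finset.card_sdiff_of_subset, G.card_neighborFinset_eq_degree, hd,
      Finset.card_eq_three.2 ⟨x, y, z, hxy, hxz, hyz, rfl⟩]
    intro u; simp; rintro (rfl | rfl | rfl) <;> assumption
  obtain ⟨w, hw⟩ := Finset.card_eq_one.1 hc
  have h : ∀ u, (G.Adj v u ∧ ¬ (u = x ∨ u = y ∨ u = z)) ↔ u = w := by
    intro u
    have := congrArg (u ∈ ·) hw
    simpa using this
  exact ⟨w, by grind, by grind, by grind, by grind⟩

lemma nbr_cut {V : Type*} [Fintype V] [DecidableEq V] {G : SimpleGraph V} [DecidableRel G.Adj]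
    (v : V) (hd : G.degree v + 1 < Fintype.card V) : IsVertexCut G (G.neighborFinset v) := by
  refine cut_of_card {v} _ v (by simp) (by simp) ?_ ?_
  · simp; omega
  · intro x hx y hxy
    simp at hx
    subst hx
    right; simpa using hxy

/-- In the 4-connected 4-regular case there is no `K₄`. -/
lemma no_k4 {V : Type*} [Fintype V] [DecidableEq V] {G : SimpleGraph V} [DecidableRel G.Adj]
    (h7 : 7 ≤ Fintype.card V) (hreg : ∀ v, G.degree v = 4)
    (hmin : ∀ S, IsVertexCut G S → 4 ≤ S.card)
    (hcore : ∀ S, IsVertexCut G S → S.card = 4 → ∃ C ⊆ S, C.Nonempty ∧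
      ∀ x ∈ C, ∃ y ∈ C, ∃ z ∈ C, y ≠ z ∧ G.Adj x y ∧ G.Adj x z)
    (v a b c : V) (hva : G.Adj v a) (hvb : G.Adj v b) (hvc : G.Adj v c)
    (hab : G.Adj a b) (hac : G.Adj a c) (hbc : G.Adj b c) : False := by
  have n1 := hva.ne
  have n2 := hvb.ne
  have n3 := hvc.ne
  have n4 := hab.ne
  have n5 := hac.ne
  have n6 := hbc.ne
  -- two vertices of a `K₄` never share their outside neighbour
  have share : ∀ p q r s t : V, G.Adj p q → G.Adj p r → G.Adj p s → G.Adj q r → G.Adj q s →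
      G.Adj r s → G.Adj p t → G.Adj q t → t ≠ r → t ≠ s → False := by
    intro p q r s t hpq hpr hps hqr hqs hrs hpt hqt htr hts
    obtain ⟨w, _, _, _, hw⟩ := nbr_four (hreg p) hpq hpr hps hqr.ne hqs.ne hrs.ne
    obtain ⟨w', _, _, _, hw'⟩ := nbr_four (hreg q) hpq.symm hqr hqs hpr.ne hps.ne hrs.ne
    have e1 : t = w := by have := (hw t).1 hpt; have := hqt.ne; grind
    have e2 : t = w' := by have := (hw' t).1 hqt; have := hpt.ne; grind
    have hcut : IsVertexCut G {r, s, t} := by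
      refine cut_of_card {p, q} {r, s, t} p (by simp) ?_ ?_ ?_
      · have := hpr.ne; have := hps.ne; have := hpt.ne; simp; tauto
      · have := Finset.card_le_two (a := p) (b := q)
        have := Finset.card_le_three (a := r) (b := s) (c := t)
        omega
      · intro x hx y hxy
        simp at hx ⊢
        rcases hx with rfl | rfl
        · have := (hw y).1 hxy; grind
        · have := (hw' y).1 hxy; grind
    have := hmin _ hcut
    have := Finset.card_le_three (a := r) (b := s) (c := t)
    omega
  obtain ⟨v', _, _, _, hv'⟩ := nbr_four (hreg v) hva hvb hvc n4 n5 n6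
  obtain ⟨c', _, _, _, hc'⟩ := nbr_four (hreg c) hvc.symm hac.symm hbc.symm n1 n2 n4
  have hvv' : G.Adj v v' := by rw [hv']; tauto
  have hcc' : G.Adj c c' := by rw [hc']; tauto
  have hne : v' ≠ c' := by
    rintro rfl
    exact share v c a b v' hvc hva hvb hac.symm hbc.symm hab hvv' hcc' (by tauto) (by tauto)
  have hcut : IsVertexCut G {a, b, c', v'} := by
    refine cut_of_card {v, c} {a, b, c', v'} v (by simp) ?_ ?_ ?_
    · have := hvv'.ne; simp; grind
    · have := Finset.card_le_two (a := v) (b := c)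
      have := Finset.card_le_four (a := a) (b := b) (c := c') (d := v')
      omega
    · intro x hx y hxy
      simp at hx ⊢
      rcases hx with rfl | rfl
      · have := (hv' y).1 hxy; grind
      · have := (hc' y).1 hxy; grind
  have hcard : ({a, b, c', v'} : Finset V).card = 4 := by
    rw [Finset.card_eq_succ]
    refine ⟨a, {b, c', v'}, ?_, rfl, Finset.card_eq_three.2 ⟨b, c', v', by grind, by grind, by grind, rfl⟩⟩
    simp; grind
  have k1 : ¬ G.Adj a v' := fun h => share v a b c v' hva hvb hvc hab hac hbc hvv' h (by tauto) (by tauto)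
  have k2 : ¬ G.Adj b v' := fun h => share v b a c v' hvb hva hvc hab.symm hbc hac hvv' h (by tauto) (by tauto)
  have k3 : ¬ G.Adj a c' := fun h => share c a v b c' hac.symm hvc.symm hbc.symm hva.symm hab hvb hcc' h (by tauto) (by tauto)
  have k4 : ¬ G.Adj b c' := fun h => share c b v a c' hbc.symm hvc.symm hac.symm hvb.symm hab.symm hva hcc' h (by tauto) (by tauto)
  obtain ⟨C, hCS, ⟨x, hx⟩, hC⟩ := hcore _ hcut hcard
  obtain ⟨y, hy, z, hz, hyz, hxy, hxz⟩ := hC x hx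
  have mx := hCS hx
  have my := hCS hy
  have mz := hCS hz
  have := hxy.ne
  have := hxz.ne
  simp only [Finset.mem_insert, Finset.mem_singleton] at mx my mz
  have k1' : ¬ G.Adj v' a := fun h => k1 h.symm
  have k2' : ¬ G.Adj v' b := fun h => k2 h.symm
  have k3' : ¬ G.Adj c' a := fun h => k3 h.symm
  have k4' : ¬ G.Adj c' b := fun h => k4 h.symm
  rcases mx with rfl | rfl | rfl | rfl <;> grind

lemma case_four {V : Type*} [Fintype V] [DecidableEq V] {G : SimpleGraph V} [DecidableRel G.Adj]
    (h7 : 7 ≤ Fintype.card V) (hreg : ∀ v, G.degree v = 4)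
    (hmin : ∀ S, IsVertexCut G S → 4 ≤ S.card)
    (hcore : ∀ S, IsVertexCut G S → S.card = 4 → ∃ C ⊆ S, C.Nonempty ∧
      ∀ x ∈ C, ∃ y ∈ C, ∃ z ∈ C, y ≠ z ∧ G.Adj x y ∧ G.Adj x z) : False := by
  have hK := no_k4 h7 hreg hmin hcore
  -- every neighbour of `v` has two neighbours inside the neighbourhood of `v`
  have hloc : ∀ v x, G.Adj v x → ∃ y z, G.Adj v y ∧ G.Adj v z ∧ y ≠ z ∧ G.Adj x y ∧ G.Adj x z := by
    intro v x hvx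
    have hcard : (G.neighborFinset v).card = 4 := by
      rw [G.card_neighborFinset_eq_degree, hreg]
    obtain ⟨C, hCS, ⟨p, hp⟩, hC⟩ := hcore _ (nbr_cut v (by rw [hreg]; omega)) hcard
    have hCv : ∀ u ∈ C, G.Adj v u := fun u hu => by simpa using hCS hu
    by_cases hxC : x ∈ C
    · obtain ⟨y, hy, z, hz, h⟩ := hC x hxC
      exact ⟨y, z, hCv y hy, hCv z hz, h⟩
    · exfalso
      obtain ⟨y, hy, z, hz, hyz, hpy, hpz⟩ := hC p hp
      obtain ⟨s, hs, t, ht, hst, hys, hyt⟩ := hC y hy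
      obtain ⟨w, _, _, _, hw⟩ := nbr_four (hreg v) (hCv p hp) (hCv y hy) (hCv z hz) hpy.ne hpz.ne hyz
      have hxw : x = w := by have := (hw x).1 hvx; grind
      have hs' := (hw s).1 (hCv s hs)
      have ht' := (hw t).1 (hCv t ht)
      have e1 := hys.ne
      have e2 := hyt.ne
      have hyz' : G.Adj y z := by grind
      exact hK v p y z (hCv p hp) (hCv y hy) (hCv z hz) hpy hpz hyz'
  have : 0 < Fintype.card V := by omega
  obtain ⟨v⟩ := Fintype.card_pos_iff.1 this
  have : 0 < G.degree v := by rw [hreg]; omega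
  obtain ⟨a, hva⟩ := (G.degree_pos_iff_exists_adj v).1 this
  obtain ⟨b, d, hvb, hvd, hbd, hab, had⟩ := hloc v a hva
  obtain ⟨c, hca, hcb, hcd, hv⟩ := nbr_four (hreg v) hva hvb hvd hab.ne had.ne hbd
  have hvc : G.Adj v c := by rw [hv]; tauto
  have nbd : ¬ G.Adj b d := fun h => hK v a b d hva hvb hvd hab had h
  have hbc : G.Adj b c := by
    obtain ⟨y, z, hy, hz, hyz, h1, h2⟩ := hloc v b hvb
    have := (hv y).1 hy
    have := (hv z).1 hz
    have := h1.ne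
    have := h2.ne
    grind
  have hdc : G.Adj d c := by
    have nbd' : ¬ G.Adj d b := fun h => nbd h.symm
    obtain ⟨y, z, hy, hz, hyz, h1, h2⟩ := hloc v d hvd
    have := (hv y).1 hy
    have := (hv z).1 hz
    have := h1.ne
    have := h2.ne
    grind
  have nac : ¬ G.Adj a c := fun h => hK v a b c hva hvb hvc hab h hbc
  obtain ⟨a', ha1, ha2, ha3, ha⟩ := nbr_four (hreg a) hva.symm hab had hvb.ne hvd.ne hbd
  have haa' : G.Adj a a' := by rw [ha]; tauto
  have hca' : a' ≠ c := by rintro rfl; exact nac haa'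
  have nva' : ¬ G.Adj a' v := fun h => by
    have := (hv a').1 h.symm; have := haa'.ne; grind
  obtain ⟨y, z, hy, hz, hyz, h1, h2⟩ := hloc a a' haa'
  have hy' := (ha y).1 hy
  have hz' := (ha z).1 hz
  have g1 := h1.ne
  have g2 := h2.ne
  have hba' : G.Adj a' b := by grind
  have hda' : G.Adj a' d := by grind
  obtain ⟨b', _, _, _, hb⟩ := nbr_four (hreg b) hvb.symm hab.symm hbc hva.ne hvc.ne (Ne.symm hca)
  obtain ⟨d', _, _, _, hd⟩ := nbr_four (hreg d) hvd.symm had.symm hdc hva.ne hvc.ne (Ne.symm hca)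
  have q1 := (hb a').1 hba'.symm
  have q2 := (hd a').1 hda'.symm
  have q3 := haa'.ne
  have hcut : IsVertexCut G {c, a'} := by
    refine cut_of_card {v, a, b, d} {c, a'} v (by simp) ?_ ?_ ?_
    · have := hvc.ne; simp; grind
    · have := Finset.card_le_two (a := c) (b := a')
      have := Finset.card_le_four (a := v) (b := a) (c := b) (d := d)
      omega
    · intro x hx y hxy
      simp at hx ⊢
      rcases hx with rfl | rfl | rfl | rfl
      · have := (hv y).1 hxy; grind
      · have := (ha y).1 hxy; grind
      · have := (hb y).1 hxy; grind
      · have := (hd y).1 hxy; grind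
  have := hmin _ hcut
  have := Finset.card_le_two (a := c) (b := a')
  omega

lemma nbr_two_exists {V : Type*} [Fintype V] [DecidableEq V] {G : SimpleGraph V}
    [DecidableRel G.Adj] {v x : V} (hd : 3 ≤ G.degree v) (hx : G.Adj v x) :
    ∃ y, G.Adj v y ∧ y ≠ x := by
  have hc : 0 < ((G.neighborFinset v).erase x).card := by
    rw [Finset.card_erase_of_mem (by simpa using hx), G.card_neighborFinset_eq_degree]
    omega
  obtain ⟨y, hy⟩ := Finset.card_pos.1 hc
  simp at hy
  exact ⟨y, hy.2, hy.1⟩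

/-- The standing assumptions in the case of connectivity three. -/
structure Three {V : Type*} [Fintype V] [DecidableEq V] (G : SimpleGraph V)
    [DecidableRel G.Adj] : Prop where
  h7 : 7 ≤ Fintype.card V
  hdeg : ∀ v, 3 ≤ G.degree v
  hmin : ∀ S, IsVertexCut G S → 3 ≤ S.card
  htri : ∀ S, IsVertexCut G S → S.card = 3 → ∀ x ∈ S, ∀ y ∈ S, x ≠ y → G.Adj x y
  hsum : ∑ v, G.degree v ≤ 4 * Fintype.card V

section
variable {V : Type*} [Fintype V] [DecidableEq V] {G : SimpleGraph V} [DecidableRel G.Adj]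

lemma Three.no_pair (h : Three G) (y z : V) : ¬ IsVertexCut G {y, z} := fun hc => by
  have := h.hmin _ hc
  have := Finset.card_le_two (a := y) (b := z)
  omega

lemma Three.tri (h : Three G) {v x y : V} (hd : G.degree v = 3) (hx : G.Adj v x)
    (hy : G.Adj v y) (hxy : x ≠ y) : G.Adj x y := by
  have := h.h7
  refine h.htri _ (nbr_cut v (by omega)) (by rw [G.card_neighborFinset_eq_degree, hd]) x ?_ y ?_ hxy
  · simpa using hx
  · simpa using hy

lemma Three.exists_nbrs (h : Three G) {v x : V} (hd : G.degree v = 3) (hx : G.Adj v x) :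
    ∃ y z, y ≠ x ∧ z ≠ x ∧ z ≠ y ∧ (∀ u, G.Adj v u ↔ u = x ∨ u = y ∨ u = z) ∧
      G.Adj x y ∧ G.Adj x z ∧ G.Adj y z := by
  obtain ⟨y, hy, hyx⟩ := nbr_two_exists (h.hdeg v) hx
  obtain ⟨z, hzx, hzy, hz⟩ := nbr_three hd hx hy (Ne.symm hyx)
  have hvz : G.Adj v z := by rw [hz]; tauto
  exact ⟨y, z, hyx, hzx, hzy, hz, h.tri hd hx hy (Ne.symm hyx), h.tri hd hx hvz (Ne.symm hzx),
    h.tri hd hy hvz (Ne.symm hzy)⟩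

lemma Three.indep (h : Three G) {u v : V} (hu : G.degree u = 3) (hv : G.degree v = 3)
    (huv : G.Adj u v) : False := by
  obtain ⟨a, b, hav, hbv, hba, hN, hva, hvb, hab⟩ := h.exists_nbrs hu huv
  have hua : G.Adj u a := by rw [hN]; tauto
  have hub : G.Adj u b := by rw [hN]; tauto
  obtain ⟨c, _, _, hc⟩ := nbr_three hv huv.symm hva hua.ne
  have hb := (hc b).1 hvb
  have := hub.ne
  refine h.no_pair a b (cut_of_card {u, v} {a, b} u (by simp) ?_ ?_ ?_)
  · have := hua.ne; simp; tauto
  · have := Finset.card_le_two (a := a) (b := b)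
    have := Finset.card_le_two (a := u) (b := v)
    have := h.h7
    omega
  · intro x hx y hxy
    simp at hx ⊢
    rcases hx with rfl | rfl
    · have := (hN y).1 hxy; grind
    · have := (hc y).1 hxy; grind

lemma Three.deg4 (h : Three G) {v x b c : V} (hv : G.degree v = 3) (hbx : b ≠ x) (hcx : c ≠ x)
    (hcb : c ≠ b) (hN : ∀ u, G.Adj v u ↔ u = x ∨ u = b ∨ u = c) (hx : G.degree x = 4) :
    ∃ y, y ≠ v ∧ y ≠ b ∧ y ≠ c ∧ (∀ u, G.Adj x u ↔ u = v ∨ u = b ∨ u = c ∨ u = y) ∧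
      G.Adj y b ∧ G.Adj y c ∧ G.degree y ≠ 3 := by
  have hvx : G.Adj v x := by rw [hN]; tauto
  have hvb : G.Adj v b := by rw [hN]; tauto
  have hvc : G.Adj v c := by rw [hN]; tauto
  have hxb := h.tri hv hvx hvb (Ne.symm hbx)
  have hxc := h.tri hv hvx hvc (Ne.symm hcx)
  obtain ⟨y, hyv, hyb, hyc, hy⟩ := nbr_four hx hvx.symm hxb hxc hvb.ne hvc.ne (Ne.symm hcb)
  have hxy : G.Adj x y := by rw [hy]; tauto
  have hcut : IsVertexCut G {y, b, c} := by
    refine cut_of_card {v, x} {y, b, c} v (by simp) ?_ ?_ ?_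
    · have := hvb.ne; have := hvc.ne; simp; tauto
    · have := Finset.card_le_two (a := v) (b := x)
      have := Finset.card_le_three (a := y) (b := b) (c := c)
      have := h.h7
      omega
    · intro p hp q hpq
      simp at hp ⊢
      rcases hp with rfl | rfl
      · have := (hN q).1 hpq; grind
      · have := (hy q).1 hpq; grind
  have hcard : ({y, b, c} : Finset V).card = 3 :=
    Finset.card_eq_three.2 ⟨y, b, c, hyb, hyc, Ne.symm hcb, rfl⟩
  have hAyb := h.htri _ hcut hcard y (by simp) b (by simp) hyb
  have hAyc := h.htri _ hcut hcard y (by simp) c (by simp) hyc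
  refine ⟨y, hyv, hyb, hyc, hy, hAyb, hAyc, fun hd => ?_⟩
  obtain ⟨z, _, _, hz⟩ := nbr_three hd hxy.symm hAyb (Ne.symm hbx)
  have hz' := (hz c).1 hAyc
  refine h.no_pair b c (cut_of_card {v, x, y} {b, c} v (by simp) ?_ ?_ ?_)
  · have := hvb.ne; have := hvc.ne; simp; tauto
  · have := Finset.card_le_two (a := b) (b := c)
    have := Finset.card_le_three (a := v) (b := x) (c := y)
    have := h.h7
    omega
  · intro p hp q hpq
    simp at hp ⊢
    rcases hp with rfl | rfl | rfl
    · have := (hN q).1 hpq; grind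
    · have := (hy q).1 hpq; grind
    · have := (hz q).1 hpq; grind

lemma Three.deg4_unique (h : Three G) {v x c : V} (hv : G.degree v = 3) (hvx : G.Adj v x)
    (hvc : G.Adj v c) (hcx : c ≠ x) (hx : G.degree x = 4) (hc : G.degree c = 4) : False := by
  obtain ⟨b, hbx, hbc, hN⟩ := nbr_three hv hvx hvc (Ne.symm hcx)
  have hN' : ∀ u, G.Adj v u ↔ u = x ∨ u = b ∨ u = c := by intro u; rw [hN]; tauto
  obtain ⟨y, hyv, hyb, hyc, hy, hAyb, hAyc, -⟩ := h.deg4 hv hbx hcx (Ne.symm hbc) hN' hx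
  have hvb : G.Adj v b := by rw [hN]; tauto
  have hxc := h.tri hv hvx hvc (Ne.symm hcx)
  have hbc' := h.tri hv hvb hvc hbc
  have hxy : G.Adj x y := by rw [hy]; tauto
  obtain ⟨w, _, _, _, hw⟩ := nbr_four hc hvc.symm hxc.symm hbc'.symm hvx.ne hvb.ne (Ne.symm hbx)
  have hw' := (hw y).1 hAyc.symm
  have := hxy.ne
  refine h.no_pair b y (cut_of_card {v, x, c} {b, y} v (by simp) ?_ ?_ ?_)
  · have := hvb.ne; have := hvc.ne; simp; tauto
  · have := Finset.card_le_two (a := b) (b := y)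
    have := Finset.card_le_three (a := v) (b := x) (c := c)
    have := h.h7
    omega
  · intro p hp q hpq
    simp at hp ⊢
    rcases hp with rfl | rfl | rfl
    · have := (hN q).1 hpq; grind
    · have := (hy q).1 hpq; grind
    · have := (hw q).1 hpq; grind

lemma Three.low_nbrs (h : Three G) {v x : V} (hv : G.degree v = 3) (hvx : G.Adj v x) :
    ((Finset.univ.filter fun w => G.degree w = 3).filter fun w => G.Adj w x).card + 3 ≤
      G.degree x := by
  set Q := (Finset.univ.filter fun w => G.degree w = 3).filter fun w => G.Adj w x with hQ
  have mQ : ∀ w, w ∈ Q ↔ G.degree w = 3 ∧ G.Adj w x := by intro w; simp [hQ]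
  set P := (G.neighborFinset x).filter fun w => G.degree w ≠ 3 with hP
  have mP : ∀ w, w ∈ P ↔ G.Adj x w ∧ G.degree w ≠ 3 := by intro w; simp [hP]
  have hcard : Q.card + P.card = G.degree x := by
    rw [← G.card_neighborFinset_eq_degree,
      ← Finset.card_filter_add_card_filter_not (s := G.neighborFinset x) (fun w => G.degree w = 3)]
    congr 2
    ext w
    simp [mQ, G.adj_comm, and_comm]
  by_contra! hlt
  obtain ⟨y, z, hyx, hzx, hzy, hN, hxy, hxz, hyz⟩ := h.exists_nbrs hv hvx
  have hvy : G.Adj v y := by rw [hN]; tauto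
  have hvz : G.Adj v z := by rw [hN]; tauto
  have hPeq : {y, z} = P := by
    apply Finset.eq_of_subset_of_card_le
    · intro u hu
      simp at hu
      rw [mP]
      rcases hu with rfl | rfl
      · exact ⟨hxy, fun hh => h.indep hv hh hvy⟩
      · exact ⟨hxz, fun hh => h.indep hv hh hvz⟩
    · rw [Finset.card_pair (Ne.symm hzy)]; omega
  have mP' : ∀ w, (G.Adj x w ∧ G.degree w ≠ 3) ↔ w = y ∨ w = z := by
    intro w; rw [← mP, ← hPeq]; simp
  have hw : ∀ w ∈ Q, ∀ u, G.Adj w u → u = x ∨ u = y ∨ u = z := by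
    intro w hw u hwu
    rw [mQ] at hw
    by_cases hux : u = x
    · exact Or.inl hux
    · right
      rw [← mP']
      exact ⟨h.tri hw.1 hw.2 hwu (Ne.symm hux), fun hh => h.indep hw.1 hh hwu⟩
  by_cases hall : ∃ w, w ≠ x ∧ ¬ G.Adj x w
  · obtain ⟨w, hwx, hxw⟩ := hall
    refine h.no_pair y z (cut_of (insert x Q) {y, z} x (by simp) ?_ w ?_ ?_ ?_)
    · simp; tauto
    · simp only [Finset.mem_insert, mQ, not_or]
      exact ⟨hwx, fun hh => hxw hh.2.symm⟩
    · simp only [Finset.mem_insert, Finset.mem_singleton, not_or]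
      constructor <;> (rintro rfl; tauto)
    · intro p hp q hpq
      rw [Finset.mem_insert] at hp
      simp only [Finset.mem_insert, Finset.mem_singleton]
      rcases hp with rfl | hp
      · by_cases hq : G.degree q = 3
        · left; right; rw [mQ]; exact ⟨hq, hpq.symm⟩
        · right; rw [← mP']; exact ⟨hpq, hq⟩
      · have := hw p hp q hpq; tauto
  · push Not at hall
    have hadj : ∀ w ∈ Q, ∀ u, G.Adj w u ↔ u = x ∨ u = y ∨ u = z := by
      intro w hwQ
      have hE : G.neighborFinset w = {x, y, z} := by
        apply Finset.eq_of_subset_of_card_le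
        · intro u hu
          simp at hu ⊢
          exact hw w hwQ u hu
        · rw [G.card_neighborFinset_eq_degree, ((mQ w).1 hwQ).1]
          exact Finset.card_le_three
      intro u
      have := congrArg (u ∈ ·) hE
      simpa using this
    have hbig : ∀ p ∈ ({x, y, z} : Finset V), ∀ u, u ≠ p → G.Adj p u := by
      intro p hp u hup
      by_cases hux : u = x
      · subst hux
        simp at hp
        rcases hp with rfl | rfl | rfl
        · exact absurd rfl hup
        · exact hxy.symm
        · exact hxz.symm
      · have hxu := hall u hux
        by_cases hu : G.degree u = 3
        · have := (hadj u ((mQ u).2 ⟨hu, hxu.symm⟩) p).2 (by simpa using hp)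
          exact this.symm
        · have := (mP' u).1 ⟨hxu, hu⟩
          have := hyz.symm
          simp at hp
          rcases hp with rfl | rfl | rfl <;> grind
    have hbigd : ∀ p ∈ ({x, y, z} : Finset V), G.degree p = Fintype.card V - 1 := by
      intro p hp
      rw [← G.card_neighborFinset_eq_degree]
      have : G.neighborFinset p = Finset.univ.erase p := by
        ext u
        simp
        exact ⟨fun hh => hh.ne', hbig p hp u⟩
      rw [this, Finset.card_erase_of_mem (by simp), Finset.card_univ]
    have h3 : ({x, y, z} : Finset V).card = 3 :=
      Finset.card_eq_three.2 ⟨x, y, z, Ne.symm hyx, Ne.symm hzx, Ne.symm hzy, rfl⟩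
    have hs := Finset.sum_add_sum_compl ({x, y, z} : Finset V) (fun u => G.degree u)
    rw [Finset.sum_congr rfl hbigd, Finset.sum_const, h3] at hs
    have hs2 : ∑ u ∈ ({x, y, z} : Finset V)ᶜ, 3 ≤ ∑ u ∈ ({x, y, z} : Finset V)ᶜ, G.degree u :=
      Finset.sum_le_sum fun u _ => h.hdeg u
    rw [Finset.sum_const, Finset.card_compl, h3] at hs2
    have := h.hsum
    have := h.h7
    simp only [smul_eq_mul] at hs hs2
    omega

lemma Three.regular (h : Three G) (hreg : ∀ v, G.degree v = 4) (S : Finset V)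
    (hS : IsVertexCut G S) (hS3 : S.card = 3) : False := by
  obtain ⟨A, B, ⟨p, hpA⟩, ⟨q, hqB⟩, hcov, hA, hB, hAB⟩ := exists_sides S hS
  have htri := h.htri S hS hS3
  have hnA : ∀ a ∈ S, ∃ a1 ∈ A, G.Adj a a1 := by
    intro a ha
    by_contra! hh
    have hcut : IsVertexCut G (S.erase a) := by
      refine cut_of A _ p hpA ?_ q ?_ ?_ ?_
      · have := hA p hpA; simp; tauto
      · intro hq; exact (hA q hq).2 hqB
      · have := hB q hqB; simp; tauto
      · intro x hx y hxy
        rcases hcov y with h1 | h1 | h1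
        · right
          rw [Finset.mem_erase]
          refine ⟨?_, h1⟩
          rintro rfl
          exact hh x hx hxy.symm
        · exact Or.inl h1
        · exact absurd hxy (hAB x hx y h1)
    have := h.hmin _ hcut
    rw [Finset.card_erase_of_mem ha] at this
    omega
  have hnB : ∀ a ∈ S, ∃ a1 ∈ B, G.Adj a a1 := by
    intro a ha
    by_contra! hh
    have hcut : IsVertexCut G (S.erase a) := by
      refine cut_of B _ q hqB ?_ p ?_ ?_ ?_
      · have := hB q hqB; simp; tauto
      · intro hq; exact (hA p hpA).2 hq
      · have := hA p hpA; simp; tauto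
      · intro x hx y hxy
        rcases hcov y with h1 | h1 | h1
        · right
          rw [Finset.mem_erase]
          refine ⟨?_, h1⟩
          rintro rfl
          exact hh x hx hxy.symm
        · exact absurd hxy.symm (hAB y h1 x hx)
        · exact Or.inl h1
    have := h.hmin _ hcut
    rw [Finset.card_erase_of_mem ha] at this
    omega
  -- each vertex of the cut has exactly one neighbour in `A`
  have huniq : ∀ a ∈ S, ∀ x ∈ A, ∀ y ∈ A, G.Adj a x → G.Adj a y → x = y := by
    intro a ha x hx y hy hax hay
    by_contra hne
    obtain ⟨w, hw, haw⟩ := hnB a ha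
    have hsub : insert x (insert y (insert w (S.erase a))) ⊆ G.neighborFinset a := by
      intro u hu
      simp at hu ⊢
      rcases hu with rfl | rfl | rfl | hu
      · exact hax
      · exact hay
      · exact haw
      · exact htri a ha u hu.2 (Ne.symm hu.1)
    have hc := Finset.card_le_card hsub
    have := hA x hx
    have := hA y hy
    have := hB w hw
    rw [Finset.card_insert_of_notMem, Finset.card_insert_of_notMem, Finset.card_insert_of_notMem,
      Finset.card_erase_of_mem ha, G.card_neighborFinset_eq_degree, hreg] at hc
    · omega
    · simp; tauto
    · simp only [Finset.mem_insert, Finset.mem_erase, not_or]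
      refine ⟨?_, by tauto⟩
      rintro rfl; tauto
    · simp only [Finset.mem_insert, Finset.mem_erase, not_or]
      refine ⟨hne, ?_, by tauto⟩
      rintro rfl; tauto
  obtain ⟨a, b, c, hab, hac, hbc, rfl⟩ := Finset.card_eq_three.1 hS3
  obtain ⟨a1, ha1, haa1⟩ := hnA a (by simp)
  have hother : ∃ r ∈ A, r ≠ a1 := by
    by_contra! hh
    have hsub : G.neighborFinset a1 ⊆ {a, b, c} := by
      intro u hu
      have hu' : G.Adj a1 u := by simpa using hu
      rcases hcov u with h1 | h1 | h1
      · exact h1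
      · have := hh u h1; exact absurd this hu'.ne'
      · exact absurd hu' (hAB a1 ha1 u h1)
    have := Finset.card_le_card hsub
    rw [G.card_neighborFinset_eq_degree, hreg, hS3] at this
    omega
  obtain ⟨r, hrA, hr⟩ := hother
  have hA1 := hA a1 ha1
  have hAr := hA r hrA
  simp only [Finset.mem_insert, Finset.mem_singleton, not_or] at hA1 hAr
  have hcut : IsVertexCut G {a1, b, c} := by
    refine cut_of (A.erase a1) _ r ?_ ?_ a ?_ ?_ ?_
    · simp; tauto
    · simp; tauto
    · intro hh
      have := hA a (Finset.mem_of_mem_erase hh)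
      simp at this
    · simp; have := haa1.ne; tauto
    · intro x hx y hxy
      rw [Finset.mem_erase] at hx
      simp only [Finset.mem_erase, Finset.mem_insert, Finset.mem_singleton]
      rcases hcov y with h1 | h1 | h1
      · simp only [Finset.mem_insert, Finset.mem_singleton] at h1
        rcases h1 with rfl | h1
        · exact absurd (huniq y (by simp) x hx.2 a1 ha1 hxy.symm haa1) hx.1
        · tauto
      · tauto
      · exact absurd hxy (hAB x hx.2 y h1)
  have hcard : ({a1, b, c} : Finset V).card = 3 :=
    Finset.card_eq_three.2 ⟨a1, b, c, by tauto, by tauto, hbc, rfl⟩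
  have hb1 := h.htri _ hcut hcard b (by simp) a1 (by simp) (by tauto)
  have hc1 := h.htri _ hcut hcard c (by simp) a1 (by simp) (by tauto)
  refine h.no_pair a1 a1 (cut_of (A.erase a1) _ r ?_ ?_ q ?_ ?_ ?_)
  · simp; tauto
  · simp; tauto
  · intro hh
    exact (hA q (Finset.mem_of_mem_erase hh)).2 hqB
  · simp; rintro rfl; tauto
  · intro x hx y hxy
    rw [Finset.mem_erase] at hx
    simp only [Finset.mem_erase, Finset.mem_insert, Finset.mem_singleton]
    rcases hcov y with h1 | h1 | h1
    · exfalso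
      have hy1 : G.Adj y a1 := by
        simp only [Finset.mem_insert, Finset.mem_singleton] at h1
        rcases h1 with rfl | rfl | rfl <;> assumption
      exact hx.1 (huniq y h1 x hx.2 a1 ha1 hxy.symm hy1)
    · tauto
    · exact absurd hxy (hAB x hx.2 y h1)

lemma Three.high_nbrs (h : Three G) {v : V} (hv : G.degree v = 3) :
    2 ≤ ((Finset.univ.filter fun w => 5 ≤ G.degree w).filter fun w => G.Adj v w).card ∧
    (((Finset.univ.filter fun w => 5 ≤ G.degree w).filter fun w => G.Adj v w).card = 2 →
      ∃ x, G.Adj v x ∧ G.degree x = 4) := by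
  obtain ⟨x, hx⟩ := (G.degree_pos_iff_exists_adj v).1 (by omega)
  obtain ⟨y, z, hyx, hzx, hzy, hN, hxy, hxz, hyz⟩ := h.exists_nbrs hv hx
  have hvy : G.Adj v y := by rw [hN]; tauto
  have hvz : G.Adj v z := by rw [hN]; tauto
  have hge : ∀ u, G.Adj v u → G.degree u = 4 ∨ 5 ≤ G.degree u := by
    intro u hu
    have h1 := h.hdeg u
    have h2 : G.degree u ≠ 3 := fun hh => h.indep hv hh hu
    omega
  have pair : ∀ p q, p ≠ q → G.Adj v p → G.Adj v q → 5 ≤ G.degree p → 5 ≤ G.degree q →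
      2 ≤ ((Finset.univ.filter fun w => 5 ≤ G.degree w).filter fun w => G.Adj v w).card := by
    intro p q hpq h1 h2 h3 h4
    rw [← Finset.card_pair hpq]
    apply Finset.card_le_card
    intro u hu
    simp at hu ⊢
    rcases hu with rfl | rfl <;> tauto
  have u1 := h.deg4_unique hv hx hvy hyx
  have u2 := h.deg4_unique hv hx hvz hzx
  have u3 := h.deg4_unique hv hvy hvz hzy
  constructor
  · rcases hge x hx with g1 | g1 <;> rcases hge y hvy with g2 | g2 <;>
      rcases hge z hvz with g3 | g3
    · exact (u1 g1 g2).elim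
    · exact (u1 g1 g2).elim
    · exact (u2 g1 g3).elim
    · exact pair z y hzy hvz hvy g3 g2
    · exact (u3 g2 g3).elim
    · exact pair z x hzx hvz hx g3 g1
    · exact pair y x hyx hvy hx g2 g1
    · exact pair y x hyx hvy hx g2 g1
  · intro h2
    by_contra! hh
    have g1 := (hge x hx).resolve_left (hh x hx)
    have g2 := (hge y hvy).resolve_left (hh y hvy)
    have g3 := (hge z hvz).resolve_left (hh z hvz)
    have h3 : ({x, y, z} : Finset V).card = 3 :=
      Finset.card_eq_three.2 ⟨x, y, z, Ne.symm hyx, Ne.symm hzx, Ne.symm hzy, rfl⟩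
    have : ({x, y, z} : Finset V).card ≤
        ((Finset.univ.filter fun w => 5 ≤ G.degree w).filter fun w => G.Adj v w).card := by
      apply Finset.card_le_card
      intro u hu
      simp at hu ⊢
      rcases hu with rfl | rfl | rfl <;> tauto
    omega

set_option maxHeartbeats 2000000 in
lemma Three.false (h : Three G) (S : Finset V)
    (hS : IsVertexCut G S) (hS3 : S.card = 3) : False := by
  set T := Finset.univ.filter fun w => G.degree w = 3 with hT
  set F := Finset.univ.filter fun w => 5 ≤ G.degree w with hF
  have mT : ∀ w, w ∈ T ↔ G.degree w = 3 := by intro w; simp [hT]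
  have mF : ∀ w, w ∈ F ↔ 5 ≤ G.degree w := by intro w; simp [hF]
  have hcharge : ∑ v, G.degree v + T.card = 4 * Fintype.card V + ∑ x ∈ F, (G.degree x - 4) := by
    rw [hT, Finset.card_filter, hF, Finset.sum_filter, ← Finset.sum_add_distrib,
      show 4 * Fintype.card V = ∑ _v : V, 4 by simp [mul_comm], ← Finset.sum_add_distrib]
    apply Finset.sum_congr rfl
    intro v _
    have := h.hdeg v
    split_ifs <;> omega
  have hle : ∑ x ∈ F, (G.degree x - 4) ≤ T.card := by have := h.hsum; omega
  have hdc : ∑ v ∈ T, (F.filter fun w => G.Adj v w).card =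
      ∑ x ∈ F, (T.filter fun w => G.Adj w x).card :=
    Finset.sum_card_bipartiteAbove_eq_sum_card_bipartiteBelow (fun v x => G.Adj v x)
  have hlow : ∀ x ∈ F, (T.filter fun w => G.Adj w x).card ≤ 2 * (G.degree x - 4) ∧
      ((T.filter fun w => G.Adj w x).card = 2 * (G.degree x - 4) →
        G.degree x = 5 ∧ (T.filter fun w => G.Adj w x).card = 2) := by
    intro x hx
    rw [mF] at hx
    by_cases he : (T.filter fun w => G.Adj w x).card = 0
    · omega
    · obtain ⟨v, hv⟩ := Finset.card_pos.1 (Nat.pos_of_ne_zero he)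
      rw [Finset.mem_filter, mT] at hv
      have := h.low_nbrs hv.1 hv.2
      rw [← hT] at this
      omega
  have h2T : ∑ v ∈ T, 2 ≤ ∑ v ∈ T, (F.filter fun w => G.Adj v w).card :=
    Finset.sum_le_sum fun v hv => (h.high_nbrs ((mT v).1 hv)).1
  have h2F : ∑ x ∈ F, (T.filter fun w => G.Adj w x).card ≤ ∑ x ∈ F, 2 * (G.degree x - 4) :=
    Finset.sum_le_sum fun x hx => (hlow x hx).1
  have hc : ∑ v ∈ T, 2 = 2 * T.card := by simp [mul_comm]
  have hm : ∑ x ∈ F, 2 * (G.degree x - 4) = 2 * ∑ x ∈ F, (G.degree x - 4) := by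
    rw [Finset.mul_sum]
  have eT : ∑ v ∈ T, 2 = ∑ v ∈ T, (F.filter fun w => G.Adj v w).card := by omega
  have eF : ∑ x ∈ F, (T.filter fun w => G.Adj w x).card = ∑ x ∈ F, 2 * (G.degree x - 4) := by omega
  have eT' := (Finset.sum_eq_sum_iff_of_le fun v hv => (h.high_nbrs ((mT v).1 hv)).1).1 eT
  have eF' := (Finset.sum_eq_sum_iff_of_le fun x hx => (hlow x hx).1).1 eF
  have hfive : ∀ x, 5 ≤ G.degree x →
      G.degree x = 5 ∧ (T.filter fun w => G.Adj w x).card = 2 := fun x hx =>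
    (hlow x ((mF x).2 hx)).2 (eF' x ((mF x).2 hx))
  rcases T.eq_empty_or_nonempty with hTe | ⟨v, hvT⟩
  · refine h.regular (fun v => ?_) S hS hS3
    have h1 := h.hdeg v
    have h2 : G.degree v ≠ 3 := by rw [Ne, ← mT, hTe]; simp
    have h3 : ¬ 5 ≤ G.degree v := fun hh => by
      have := (hfive v hh).2
      rw [hTe] at this
      simp at this
    omega
  · have hv := (mT v).1 hvT
    obtain ⟨x, hvx, hx4⟩ := (h.high_nbrs hv).2 (eT' v hvT).symm
    obtain ⟨b, c, hbx, hcx, hcb, hN, hxb, hxc, hbc⟩ := h.exists_nbrs hv hvx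
    obtain ⟨y, hyv, hyb, hyc, hy, hAyb, hAyc, hy3⟩ := h.deg4 hv hbx hcx hcb hN hx4
    have hvb : G.Adj v b := by rw [hN]; simp
    have hvc : G.Adj v c := by rw [hN]; simp
    have hxy : G.Adj x y := by rw [hy]; simp
    have hfiv : ∀ p, p ≠ x → G.Adj v p → 5 ≤ G.degree p := by
      intro p hpx hvp
      have h1 := h.hdeg p
      have h2 : G.degree p ≠ 3 := fun hh => h.indep hv hh hvp
      have h3 : G.degree p ≠ 4 := fun hh => h.deg4_unique hv hvx hvp hpx hx4 hh
      omega
    have hb5 := hfive b (hfiv b hbx hvb)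
    have hc5 := hfive c (hfiv c hcx hvc)
    -- the second low vertex next to `b`
    have hw : ∃ w, G.degree w = 3 ∧ G.Adj w b ∧ w ≠ v := by
      have : 0 < ((T.filter fun w => G.Adj w b).erase v).card := by
        rw [Finset.card_erase_of_mem (by rw [Finset.mem_filter]; exact ⟨hvT, hvb⟩)]
        omega
      obtain ⟨w, hw⟩ := Finset.card_pos.1 this
      rw [Finset.mem_erase, Finset.mem_filter, mT] at hw
      exact ⟨w, hw.2.1, hw.2.2, hw.1⟩
    obtain ⟨w, hw3, hwb, hwv⟩ := hw
    have hwx : w ≠ x := by rintro rfl; omega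
    have hwc : w ≠ c := by rintro rfl; omega
    have hwy : w ≠ y := by rintro rfl; omega
    have five_set : ∀ p q, G.degree p = 5 → G.Adj p v → G.Adj p x → G.Adj p q → G.Adj p y →
        G.Adj p w → q ≠ v → q ≠ x → q ≠ y → q ≠ w →
        ∀ u, G.Adj p u → u = v ∨ u = x ∨ u = q ∨ u = y ∨ u = w := by
      intro p q hp5 h1 h2 h3 h4 h5 n1 n2 n3 n4 u hu
      have hE : ({v, x, q, y, w} : Finset V) = G.neighborFinset p := by
        apply Finset.eq_of_subset_of_card_le
        · intro t ht
          simp at ht ⊢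
          rcases ht with rfl | rfl | rfl | rfl | rfl <;> assumption
        · rw [G.card_neighborFinset_eq_degree, hp5]
          have := hvx.ne
          have := hxy.ne
          rw [Finset.card_insert_of_notMem, Finset.card_insert_of_notMem,
            Finset.card_insert_of_notMem, Finset.card_pair (Ne.symm hwy)]
          · simp [n3, n4]
          · simp [hxy.ne, Ne.symm hwx, Ne.symm n2]
          · simp [hvx.ne, Ne.symm n1, Ne.symm hyv, Ne.symm hwv]
      have : u ∈ ({v, x, q, y, w} : Finset V) := by rw [hE]; simpa using hu
      simpa using this
    have hNb := five_set b c hb5.1 hvb.symm hxb.symm hbc hAyb.symm hwb.symm hvc.ne' hcx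
      (Ne.symm hyc) (Ne.symm hwc)
    -- the neighbours of `w` are `b`, `c`, `y`
    obtain ⟨s, t, hsb, htb, hts, hNw, hbs, hbt, hst⟩ := h.exists_nbrs hw3 hwb
    have hws : G.Adj w s := by rw [hNw]; simp
    have hwt : G.Adj w t := by rw [hNw]; simp
    have hlocw : ∀ u, G.Adj w u → u ≠ b → u = c ∨ u = y := by
      intro u hu hub
      have h1 : u ≠ v := by rintro rfl; exact h.indep hw3 hv hu
      have h2 : u ≠ x := by
        rintro rfl
        rcases (hy w).1 hu.symm with r | r | r | r
        · exact hwv r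
        · exact hwb.ne r
        · exact hwc r
        · exact hwy r
      have h3 : u ≠ w := hu.ne'
      rcases hNb u (h.tri hw3 hwb hu (Ne.symm hub)) with r | r | r | r | r
      · exact absurd r h1
      · exact absurd r h2
      · exact Or.inl r
      · exact Or.inr r
      · exact absurd r h3
    have ls := hlocw s hws hsb
    have lt := hlocw t hwt htb
    have hcw : G.Adj c w := by
      rw [G.adj_comm]
      rcases ls with r | r
      · rwa [← r]
      · rcases lt with r2 | r2
        · rwa [← r2]
        · exact absurd (r2.trans r.symm) hts
    have hNc := five_set c b hc5.1 hvc.symm hxc.symm hbc.symm hAyc.symm hcw hvb.ne' hbx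
      (Ne.symm hyb) hwb.ne'
    refine h.no_pair y y (cut_of_card {v, x, b, c, w} _ v (by simp) ?_ ?_ ?_)
    · simp [Ne.symm hyv]
    · have h1 := Finset.card_le_five (a := v) (b := x) (c := b) (d := c) (e := w)
      have h2 : ({y, y} : Finset V).card = 1 := by simp
      have := h.h7
      omega
    · intro p hp q hpq
      simp only [Finset.mem_insert, Finset.mem_singleton] at hp ⊢
      rcases hp with rfl | rfl | rfl | rfl | rfl
      · rcases (hN q).1 hpq with r | r | r <;> simp [r]
      · rcases (hy q).1 hpq with r | r | r | r <;> simp [r]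
      · rcases hNb q hpq with r | r | r | r | r <;> simp [r]
      · rcases hNc q hpq with r | r | r | r | r <;> simp [r]
      · by_cases hqb : q = b
        · simp [hqb]
        · rcases hlocw q hpq hqb with r | r <;> simp [r]

end

/-- Every connected graph of order `n ≥ 7` and size at most `2n` has a
foresty minimum vertex cut. -/
theorem foresty_minimum_vertex_cut_of_size_le
    {V : Type*} [Fintype V] (G : SimpleGraph V) (n : ℕ)
    (hn : Fintype.card V = n) (h7 : 7 ≤ n)
    (hconn : G.Connected)
    (hsize : G.edgeSet.ncard ≤ 2 * n) :
    ∃ S : Finset V, IsVertexCut G S ∧ S.card = graphConnectivity G ∧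
      (G.induce (S : Set V)).IsAcyclic := by
  classical
  subst hn
  have hsum : ∑ v, G.degree v ≤ 4 * Fintype.card V := by
    rw [G.sum_degrees_eq_twice_card_edges]
    rw [← G.coe_edgeFinset, Set.ncard_coe_finset] at hsize
    omega
  have hlow : ∃ v, G.degree v ≤ 4 := by
    by_contra! hh
    have : ∑ _v : V, 5 ≤ ∑ v, G.degree v := Finset.sum_le_sum fun v _ => hh v
    simp at this
    omega
  obtain ⟨v0, hv0⟩ := hlow
  have hne : {k | ∃ S : Finset V, IsVertexCut G S ∧ S.card = k}.Nonempty :=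
    ⟨_, _, nbr_cut v0 (by omega), rfl⟩
  obtain ⟨S0, hS0, hS0k⟩ : ∃ S : Finset V, IsVertexCut G S ∧ S.card = graphConnectivity G :=
    Nat.sInf_mem hne
  have hmin : ∀ S, IsVertexCut G S → graphConnectivity G ≤ S.card := fun S hS =>
    Nat.sInf_le ⟨S, hS, rfl⟩
  generalize graphConnectivity G = k at *
  by_contra! hno
  have hcore : ∀ S, IsVertexCut G S → S.card = k → ∃ C ⊆ S, C.Nonempty ∧
      ∀ x ∈ C, ∃ y ∈ C, ∃ z ∈ C, y ≠ z ∧ G.Adj x y ∧ G.Adj x z := fun S hS hSk =>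
    core_of_not_acyclic S (hno S hS hSk)
  have hk4 : k ≤ 4 := by
    have := hmin _ (nbr_cut v0 (by omega))
    rw [G.card_neighborFinset_eq_degree] at this
    omega
  have hdeg : ∀ v, k ≤ G.degree v := by
    intro v
    by_cases hv : G.degree v + 1 < Fintype.card V
    · have := hmin _ (nbr_cut v hv)
      rwa [G.card_neighborFinset_eq_degree] at this
    · omega
  have hk3 : 3 ≤ k := by
    obtain ⟨C, hCS, ⟨x, hx⟩, hC⟩ := hcore S0 hS0 hS0k
    obtain ⟨y, hy, z, hz, hyz, hxy, hxz⟩ := hC x hx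
    have h3 : ({x, y, z} : Finset V).card = 3 :=
      Finset.card_eq_three.2 ⟨x, y, z, hxy.ne, hxz.ne, hyz, rfl⟩
    rw [← h3, ← hS0k]
    apply Finset.card_le_card
    intro u hu
    simp at hu
    rcases hu with rfl | rfl | rfl <;> (apply hCS; assumption)
  obtain rfl | rfl : k = 3 ∨ k = 4 := by omega
  · refine Three.false (G := G) ⟨h7, hdeg, hmin, ?_, hsum⟩ S0 hS0 hS0k
    intro S hS hS3 p hp q hq hpq
    obtain ⟨C, hCS, ⟨x, hx⟩, hC⟩ := hcore S hS hS3
    obtain ⟨y, hy, z, hz, hyz, hxy, hxz⟩ := hC x hx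
    have h3 : ({x, y, z} : Finset V).card = 3 :=
      Finset.card_eq_three.2 ⟨x, y, z, hxy.ne, hxz.ne, hyz, rfl⟩
    have hsub : ({x, y, z} : Finset V) ⊆ C := by
      intro u hu
      simp at hu
      rcases hu with rfl | rfl | rfl <;> assumption
    have hSe : ({x, y, z} : Finset V) = S :=
      Finset.eq_of_subset_of_card_le (hsub.trans hCS) (by omega)
    have hCe : C = {x, y, z} := by
      apply Finset.Subset.antisymm _ hsub
      rw [hSe]; exact hCS
    rw [← hSe, ← hCe] at hp hq
    obtain ⟨s, hs, t, ht, hst, hps, hpt⟩ := hC p hp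
    rw [hCe] at hp hq hs ht
    simp at hp hq hs ht
    have := hps.ne
    have := hpt.ne
    grind
  · have hreg : ∀ v, G.degree v = 4 := by
      have h4 : ∑ _v : V, 4 = 4 * Fintype.card V := by simp [mul_comm]
      have hle : ∑ _v : V, 4 ≤ ∑ v, G.degree v := Finset.sum_le_sum fun v _ => hdeg v
      have he : ∑ _v : V, 4 = ∑ v, G.degree v := by omega
      intro v
      exact ((Finset.sum_eq_sum_iff_of_le fun v _ => hdeg v).1 he v (Finset.mem_univ v)).symm
    exact case_four h7 hreg hmin hcore
end

section
/- Every connected finite simple graph of order n and size at most 2n − 4 is fragile, i.e., it contains an independent vertex cut. -/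
open SimpleGraph

open Classical in
/-- Ordered pairs of adjacent vertices inside `W`. -/
noncomputable def adjPairs {V : Type*} (G : SimpleGraph V) (W : Finset V) : Finset (V × V) :=
  (W ×ˢ W).filter (fun p => G.Adj p.1 p.2)

lemma mem_adjPairs {V : Type*} (G : SimpleGraph V) (W : Finset V) (p : V × V) :
    p ∈ adjPairs G W ↔ (p.1 ∈ W ∧ p.2 ∈ W) ∧ G.Adj p.1 p.2 := by
  simp [adjPairs]

/-- Contract `x` into `u`. -/
def contractInto {V : Type*} (G : SimpleGraph V) (u x : V) : SimpleGraph V where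
  Adj a b := a ≠ b ∧ (G.Adj a b ∨ (a = u ∧ G.Adj x b) ∨ (b = u ∧ G.Adj x a))
  symm := ⟨by
    rintro a b ⟨h, h1⟩
    refine ⟨h.symm, ?_⟩
    rcases h1 with h1 | h1 | h1
    · exact Or.inl h1.symm
    · exact Or.inr (Or.inr h1)
    · exact Or.inr (Or.inl h1)⟩
  loopless := ⟨fun a h => h.1 rfl⟩

/-- `S`, `A`, `B` partition `W`, with `A`, `B` nonempty and no edges between them. -/
def Splits3 {V : Type*} (G : SimpleGraph V) (W S A B : Finset V) : Prop :=
  A.Nonempty ∧ B.Nonempty ∧ (∀ v, v ∈ W ↔ (v ∈ S ∨ v ∈ A ∨ v ∈ B)) ∧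
  (∀ v ∈ A, v ∉ S ∧ v ∉ B) ∧ (∀ v ∈ B, v ∉ S) ∧ ∀ a ∈ A, ∀ b ∈ B, ¬ G.Adj a b

lemma Splits3.swap {V : Type*} {G : SimpleGraph V} {W S A B : Finset V}
    (h : Splits3 G W S A B) : Splits3 G W S B A := by
  obtain ⟨h1, h2, h3, h4, h5, h6⟩ := h
  refine ⟨h2, h1, fun v => by rw [h3 v]; tauto, fun v hv => ⟨h5 v hv, fun h => (h4 v h).2 hv⟩,
    fun v hv => (h4 v hv).1, fun a ha b hb h => h6 b hb a ha h.symm⟩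

/-- There is a stable cut of `G[W]` which avoids `u` or equals `{u}`. -/
def GoodCut {V : Type*} (G : SimpleGraph V) (W : Finset V) (u : V) : Prop :=
  ∃ S A B : Finset V, Splits3 G W S A B ∧ (∀ a ∈ S, ∀ b ∈ S, ¬ G.Adj a b) ∧
    (u ∈ S → ∀ v ∈ S, v = u)

open Classical in
lemma card_contract {V : Type*} (G : SimpleGraph V) (W : Finset V) (u x y : V)
    (hu : u ∈ W) (hx : x ∈ W) (hy : y ∈ W) (hux : G.Adj u x) (huy : G.Adj u y)
    (hxy : G.Adj x y) :
    (adjPairs (contractInto G u x) (W.erase x)).card + 4 ≤ (adjPairs G W).card := by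
  set Q : Finset (V × V) := {(u, x), (x, u), (x, y), (y, x)} with hQ
  have hQc : Q.card = 4 := by
    have h1 := hux.ne
    have h2 := huy.ne
    have h3 := hxy.ne
    rw [hQ, Finset.card_insert_of_notMem, Finset.card_insert_of_notMem,
      Finset.card_insert_of_notMem, Finset.card_singleton] <;>
    simp [h1, h2, h3, h1.symm, h2.symm, h3.symm]
  have hQs : Q ⊆ adjPairs G W := by
    intro p hp
    rw [mem_adjPairs]
    simp only [hQ, Finset.mem_insert, Finset.mem_singleton] at hp
    rcases hp with rfl | rfl | rfl | rfl <;> simp [*, hux.symm, hxy.symm]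
  have key : (adjPairs (contractInto G u x) (W.erase x)).card ≤ (adjPairs G W \ Q).card := by
    apply Finset.card_le_card_of_surjOn
      (fun p : V × V => ((if p.1 = x then u else p.1), (if p.2 = x then u else p.2)))
    rintro ⟨a, b⟩ hp
    rw [Finset.mem_coe, mem_adjPairs] at hp
    simp only [Finset.mem_erase] at hp
    obtain ⟨⟨⟨hax, haW⟩, hbx, hbW⟩, hab, h⟩ := hp
    have hmem : ∀ p : V × V, p.1 ∈ W → p.2 ∈ W → G.Adj p.1 p.2 → p ∉ Q →
      p ∈ (↑(adjPairs G W \ Q) : Set (V × V)) := by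
      intro p h1 h2 h3 h4
      rw [Finset.mem_coe, Finset.mem_sdiff, mem_adjPairs]
      exact ⟨⟨⟨h1, h2⟩, h3⟩, h4⟩
    by_cases hG : G.Adj a b
    · refine ⟨(a, b), hmem _ haW hbW hG ?_, ?_⟩
      · simp [hQ, hax, hbx]
      · simp [hax, hbx]
    · rcases h with h | ⟨rfl, h⟩ | ⟨rfl, h⟩
      · exact absurd h hG
      · refine ⟨(x, b), hmem _ hx hbW h ?_, ?_⟩
        · have : b ≠ y := by rintro rfl; exact hG huy
          simp [hQ, hbx, hab.symm, this]
        · simp [hbx]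
      · refine ⟨(a, x), hmem _ haW hx h.symm ?_, ?_⟩
        · have : a ≠ y := by rintro rfl; exact hG huy.symm
          simp [hQ, hax, hab, this]
        · simp [hax]
  rw [Finset.card_sdiff_of_subset hQs, hQc] at key
  have := Finset.card_le_card hQs
  omega

/-- A good cut of one side of an edge 2-cut gives a good cut of the whole graph. -/
lemma good_of_side {V : Type*} (G : SimpleGraph V) (W A B W1 : Finset V) (u x : V)
    (hux : G.Adj u x) (huW : u ∈ W1) (hxW : x ∈ W1)
    (hW1 : ∀ v, v ∈ W1 ↔ (v = u ∨ v = x ∨ v ∈ A))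
    (hW : ∀ v, v ∈ W ↔ (v ∈ W1 ∨ v ∈ B)) (hdis : ∀ v ∈ B, v ∉ W1)
    (hAB : ∀ a ∈ A, ∀ b ∈ B, ¬ G.Adj a b) (h : GoodCut G W1 u) : GoodCut G W u := by
  classical
  obtain ⟨S, A1, B1, hs, hst, hu⟩ := h
  have main : ∀ A1 B1 : Finset V, Splits3 G W1 S A1 B1 → u ∉ B1 → x ∉ B1 → GoodCut G W u := by
    intro A1 B1 hs huB hxB
    obtain ⟨h1, h2, h3, h4, h5, h6⟩ := hs
    refine ⟨S, A1 ∪ B, B1, ⟨h1.mono Finset.subset_union_left, h2, ?_, ?_, h5, ?_⟩, hst, hu⟩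
    · intro v
      rw [hW, h3, Finset.mem_union]; tauto
    · intro v hv
      rcases Finset.mem_union.1 hv with hv | hv
      · exact h4 v hv
      · have := hdis v hv
        rw [h3] at this
        tauto
    · intro a ha b hb hab
      rcases Finset.mem_union.1 ha with ha | ha
      · exact h6 a ha b hb hab
      · rcases (hW1 b).1 ((h3 b).2 (Or.inr (Or.inr hb))) with rfl | rfl | hbA
        · exact huB hb
        · exact hxB hb
        · exact hAB b hbA a ha hab.symm
  by_cases hc : u ∉ B1 ∧ x ∉ B1
  · exact main A1 B1 hs hc.1 hc.2
  · have hs' := hs.swap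
    obtain ⟨h1, h2, h3, h4, h5, h6⟩ := hs
    refine main B1 A1 hs' ?_ ?_
    · intro huA
      have := (h4 u huA).2
      have hxB : x ∈ B1 := by tauto
      exact h6 u huA x hxB hux
    · intro hxA
      have := (h4 x hxA).2
      have huB : u ∈ B1 := by tauto
      exact h6 x hxA u huB hux.symm

set_option maxHeartbeats 1000000 in
open Classical in
lemma good_main {V : Type*} (k : ℕ) : ∀ (G : SimpleGraph V) (W : Finset V) (u : V),
    W.card = k → u ∈ W → (adjPairs G W).card + 7 ≤ 4 * W.card → GoodCut G W u := by
  induction k using Nat.strong_induction_on with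
  | _ k ih =>
  intro G W u hk hu hsz
  by_cases htri : ∃ x ∈ W, ∃ y ∈ W, G.Adj u x ∧ G.Adj u y ∧ G.Adj x y
  · obtain ⟨x, hx, y, hy, hux, huy, hxy⟩ := htri
    have hc := card_contract G W u x y hu hx hy hux huy hxy
    have hWe := Finset.card_erase_add_one hx
    obtain ⟨S, A, B, ⟨h1, h2, h3, h4, h5, h6⟩, hst, huS⟩ :=
      ih (W.erase x).card (by omega) (contractInto G u x) (W.erase x) u rfl
        (Finset.mem_erase.2 ⟨hux.ne, hu⟩) (by omega)
    have hxn : x ∉ S ∧ x ∉ A ∧ x ∉ B := by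
      have := h3 x
      simp at this; tauto
    by_cases huS' : u ∈ S
    · have hW : ∀ v, v ∈ W ↔ (v = u ∨ v = x ∨ v ∈ A ∨ v ∈ B) := by
        intro v
        by_cases hvx : v = x
        · subst hvx; simp [hx]
        · have := h3 v
          simp only [Finset.mem_erase, ne_eq, hvx, not_false_eq_true, true_and] at this
          rw [this]
          constructor
          · rintro (h | h)
            · exact Or.inl (huS huS' v h)
            · exact Or.inr (Or.inr h)
          · rintro (rfl | h | h)
            · exact Or.inl huS'
            · exact absurd h hvx
            · exact Or.inr h
      have huA : u ∉ A := fun h => (h4 u h).1 huS'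
      have huB : u ∉ B := fun h => h5 u h huS'
      have hABd : Disjoint A B := Finset.disjoint_left.2 fun v hv => (h4 v hv).2
      have hAB : ∀ a ∈ A, ∀ b ∈ B, ¬ G.Adj a b := fun a ha b hb h =>
        h6 a ha b hb ⟨h.ne, Or.inl h⟩
      set W1 := insert u (insert x A) with hW1
      set W2 := insert u (insert x B) with hW2
      have c1 : W1.card = A.card + 2 := by
        rw [hW1, Finset.card_insert_of_notMem, Finset.card_insert_of_notMem hxn.2.1]
        simp [hux.ne, huA]
      have c2 : W2.card = B.card + 2 := by
        rw [hW2, Finset.card_insert_of_notMem, Finset.card_insert_of_notMem hxn.2.2]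
        simp [hux.ne, huB]
      have c0 : W.card = A.card + B.card + 2 := by
        have : W = insert u (insert x (A ∪ B)) := by
          ext v; simp [hW]
        rw [this, Finset.card_insert_of_notMem, Finset.card_insert_of_notMem,
          Finset.card_union_of_disjoint hABd]
        · simp [hxn]
        · simp [hux.ne, huA, huB]
      have ce : (adjPairs G W1).card + (adjPairs G W2).card ≤ (adjPairs G W).card + 2 := by
        rw [← Finset.card_union_add_card_inter]
        apply add_le_add
        · apply Finset.card_le_card
          intro p hp
          rw [Finset.mem_union, mem_adjPairs, mem_adjPairs] at hp
          rw [mem_adjPairs, hW, hW]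
          simp only [hW1, hW2, Finset.mem_insert] at hp
          tauto
        · refine (Finset.card_le_card (t := {(u, x), (x, u)}) ?_).trans Finset.card_le_two
          rintro ⟨a, b⟩ hp
          rw [Finset.mem_inter, mem_adjPairs, mem_adjPairs] at hp
          simp only [hW1, hW2, Finset.mem_insert] at hp
          obtain ⟨⟨⟨ha1, hb1⟩, hadj⟩, ⟨ha2, hb2⟩, -⟩ := hp
          have fa := fun h => (h4 a h).2
          have fb := fun h => (h4 b h).2
          have ha : a = u ∨ a = x := by
            clear hb1 hb2 fb
            rcases ha1 with h | h | h
            · exact Or.inl h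
            · exact Or.inr h
            · rcases ha2 with h' | h' | h'
              · exact Or.inl h'
              · exact Or.inr h'
              · exact absurd h' (fa h)
          have hb : b = u ∨ b = x := by
            rcases hb1 with h | h | h
            · exact Or.inl h
            · exact Or.inr h
            · rcases hb2 with h' | h' | h'
              · exact Or.inl h'
              · exact Or.inr h'
              · exact absurd h' (fb h)
          clear_value W1 W2
          rcases ha with ha | ha <;> rcases hb with hb | hb
          · exact absurd (ha.trans hb.symm) hadj.ne
          · simp [ha, hb]
          · simp [ha, hb]
          · exact absurd (ha.trans hb.symm) hadj.ne
      have a1 := h1.card_pos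
      have a2 := h2.card_pos
      by_cases hs1 : (adjPairs G W1).card + 7 ≤ 4 * W1.card
      · refine good_of_side G W A B W1 u x hux (by simp [hW1]) (by simp [hW1]) (by simp [hW1])
          ?_ ?_ hAB (ih W1.card (by omega) G W1 u rfl (by simp [hW1]) hs1)
        · intro v; rw [hW]; simp only [hW1, Finset.mem_insert]; tauto
        · intro v hv; simp only [hW1, Finset.mem_insert]
          rintro (rfl | rfl | h)
          · exact huB hv
          · exact hxn.2.2 hv
          · exact (h4 v h).2 hv
      · refine good_of_side G W B A W2 u x hux (by simp [hW2]) (by simp [hW2]) (by simp [hW2])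
          ?_ ?_ (fun a ha b hb h => hAB b hb a ha h.symm)
          (ih W2.card (by omega) G W2 u rfl (by simp [hW2]) (by omega))
        · intro v; rw [hW]; simp only [hW2, Finset.mem_insert]; tauto
        · intro v hv; simp only [hW2, Finset.mem_insert]
          rintro (rfl | rfl | h)
          · exact huA hv
          · exact hxn.2.1 hv
          · exact (h4 v hv).2 h
    · have main : ∀ A B : Finset V, Splits3 (contractInto G u x) (W.erase x) S A B →
          u ∈ A → GoodCut G W u := by
        rintro A B ⟨h1, h2, h3, h4, h5, h6⟩ huA
        have hxn : x ∉ S ∧ x ∉ A ∧ x ∉ B := by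
          have := h3 x
          simp at this; tauto
        refine ⟨S, insert x A, B, ⟨by simp, h2, ?_, ?_, h5, ?_⟩, ?_, fun h => absurd h huS'⟩
        · intro v
          have := h3 v
          by_cases hvx : v = x
          · subst hvx; simp [hx]
          · simpa [hvx] using this
        · intro v hv
          rcases Finset.mem_insert.1 hv with rfl | hv
          · tauto
          · exact h4 v hv
        · intro a ha b hb hab
          rcases Finset.mem_insert.1 ha with rfl | ha
          · have hub : u ≠ b := by rintro rfl; exact (h4 u huA).2 hb
            exact h6 u huA b hb ⟨hub, Or.inr (Or.inl ⟨rfl, hab⟩)⟩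
          · exact h6 a ha b hb ⟨hab.ne, Or.inl hab⟩
        · intro a ha b hb hab
          exact hst a ha b hb ⟨hab.ne, Or.inl hab⟩
      have hs : Splits3 (contractInto G u x) (W.erase x) S A B := ⟨h1, h2, h3, h4, h5, h6⟩
      rcases (h3 u).1 (Finset.mem_erase.2 ⟨hux.ne, hu⟩) with h | h | h
      · exact absurd h huS'
      · exact main A B hs h
      · exact main B A hs.swap h
  · push Not at htri
    by_cases hall : ∃ z ∈ W, z ≠ u ∧ ¬ G.Adj u z
    · obtain ⟨z, hz, hzu, hzn⟩ := hall
      refine ⟨W.filter (G.Adj u), {u}, W.filter (fun v => v ≠ u ∧ ¬ G.Adj u v),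
        ⟨by simp, ⟨z, by simp [*]⟩, ?_, ?_, ?_, ?_⟩, ?_, ?_⟩
      · intro v
        simp only [Finset.mem_filter, Finset.mem_singleton]
        by_cases hvu : v = u
        · subst hvu; simp [hu]
        · tauto
      · simp
      · simp only [Finset.mem_filter]; tauto
      · simp only [Finset.mem_filter, Finset.mem_singleton]
        rintro a rfl b hb; exact hb.2.2
      · simp only [Finset.mem_filter]
        intro a ha b hb
        exact htri a ha.1 b hb.1 ha.2 hb.2
      · simp
    · push Not at hall
      have h3 : 3 ≤ W.card := by
        by_contra hlt
        have h2 : W.card = 2 := by omega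
        obtain ⟨z, hz, hzu⟩ := Finset.exists_mem_ne (by omega : 1 < W.card) u
        have hadj := hall z hz hzu
        have : ({(u, z), (z, u)} : Finset (V × V)) ⊆ adjPairs G W := by
          intro p hp
          rw [mem_adjPairs]
          simp only [Finset.mem_insert, Finset.mem_singleton] at hp
          rcases hp with rfl | rfl <;> simp [*, hadj.symm]
        have hc := Finset.card_le_card this
        rw [Finset.card_pair (by simp [hzu])] at hc
        omega
      have he := Finset.card_erase_add_one hu
      obtain ⟨a, ha, b, hb, hab⟩ := Finset.one_lt_card.1 (by omega : 1 < (W.erase u).card)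
      rw [Finset.mem_erase] at ha hb
      refine ⟨{u}, {a}, (W.erase u).erase a, ⟨by simp, ⟨b, by simp [*, hab.symm]⟩, ?_, ?_, ?_, ?_⟩,
        by simp, by simp⟩
      · intro v
        simp only [Finset.mem_erase, Finset.mem_singleton]
        by_cases hvu : v = u
        · subst hvu; simp [hu]
        · by_cases hva : v = a
          · subst hva; simp [ha]
          · simp [hvu, hva]
      · simp [ha.1]
      · simp; tauto
      · simp only [Finset.mem_erase, Finset.mem_singleton]
        rintro a' rfl c ⟨hc1, hc2, hc3⟩
        exact htri a' ha.2 c hc3 (hall a' ha.2 ha.1) (hall c hc3 hc2)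

lemma card_adjPairs_univ {V : Type*} [Fintype V] (G : SimpleGraph V) :
    (adjPairs G Finset.univ).card = 2 * G.edgeSet.ncard := by
  classical
  rw [← SimpleGraph.coe_edgeFinset, Set.ncard_coe_finset, ← SimpleGraph.sum_degrees_eq_twice_card_edges]
  rw [adjPairs, Finset.univ_product_univ, Finset.card_filter, Fintype.sum_prod_type]
  refine Finset.sum_congr rfl fun v _ => ?_
  rw [← Finset.card_filter, ← SimpleGraph.card_neighborFinset_eq_degree,
    SimpleGraph.neighborFinset_eq_filter]

/-- Every connected graph of order `n` and size at most `2n - 4` is fragile: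
it contains an independent vertex cut. -/
theorem fragile_of_size_le
    {V : Type*} [Fintype V] (G : SimpleGraph V) (n : ℕ)
    (hn : Fintype.card V = n) (hconn : G.Connected)
    (hsize : (G.edgeSet.ncard : ℤ) ≤ 2 * n - 4) :
    ∃ S : Finset V, IsVertexCut G S ∧ ∀ a ∈ S, ∀ b ∈ S, ¬ G.Adj a b := by
  obtain ⟨u⟩ := hconn.nonempty
  obtain ⟨S, A, B, ⟨⟨a, ha⟩, ⟨b, hb⟩, h3, h4, h5, h6⟩, hst, -⟩ :=
    good_main _ G Finset.univ u rfl (Finset.mem_univ u) (by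
      rw [card_adjPairs_univ, Finset.card_univ, hn]; omega)
  refine ⟨S, ⟨fun h => (h4 a ha).1 ?_, fun hc => ?_⟩, hst⟩
  · have : a ∈ (S : Set V) := by rw [h]; trivial
    exact this
  · have haS : a ∈ ((S : Set V)ᶜ) := fun h => (h4 a ha).1 h
    have hbS : b ∈ ((S : Set V)ᶜ) := fun h => h5 b hb h
    obtain ⟨w⟩ := hc.preconnected ⟨a, haS⟩ ⟨b, hbS⟩
    have key : ∀ (p q : ((S : Set V)ᶜ : Set V)),
        (G.induce ((S : Set V)ᶜ)).Walk p q → p.1 ∈ A → q.1 ∈ A := by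
      intro p q w
      induction w with
      | nil => exact id
      | @cons p q r hadj _ ihw =>
        intro hp
        apply ihw
        rcases (h3 q.1).1 (Finset.mem_univ _) with h | h | h
        · exact absurd h q.2
        · exact h
        · exact absurd hadj (h6 p.1 hp q.1 h)
    exact (h4 b (key _ _ w ha)).2 hb
end
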